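/- Let Γ and Λ be infinite finitely generated torsion-free nilpotent groups, with fixed finite symmetric generating sets S_Γ, S_Λ containing the identity, and suppose Γ has polynomial growth of degree r_Γ ≥ 1 and Λ has polynomial growth of degree r_Λ ≥ 1. Then there exists an orbit equivalence coupling between Γ and Λ which is (L^p,L^q)-integrable for every 0 < p < r_Λ/r_Γ and every 0 < q < r_Γ/r_Λ. -/

import Mathlib

open MeasureTheory

universe u v

open scoped Pointwise in
/-- The word length of `g` with respect to a symmetric generating set `S` containing the
identity: the least `n` with `g ∈ S^n` (where `S^0 = {1}`). -/
noncomputable def wordLength {G : Type*} [Group G] (S : Set G) (g : G) : ℕ :=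
  sInf {n : ℕ | g ∈ S ^ n}

/-- `Γ` has polynomial growth of degree `r` with respect to the generating set `S`:
there is `C ≥ 1` with `C⁻¹·n^r ≤ #{γ : |γ|_S ≤ n} ≤ C·n^r` for all `n ≥ 1`. -/
def HasPolynomialGrowthDeg {Γ : Type*} [Group Γ] (S : Set Γ) (r : ℕ) : Prop :=
  ∃ C : ℝ, 1 ≤ C ∧ ∀ n : ℕ, 1 ≤ n →
    (n : ℝ) ^ r ≤ C * (Nat.card {γ : Γ // wordLength S γ ≤ n}) ∧
    (Nat.card {γ : Γ // wordLength S γ ≤ n} : ℝ) ≤ C * (n : ℝ) ^ r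

/-- An orbit equivalence coupling between countable groups `Γ` and `Λ`: measure-preserving,
essentially free Borel actions on standard Borel probability spaces together with a Borel
isomorphism `f` matching orbits almost everywhere, equipped with its associated measurable
cocycles `alpha`, `beta` satisfying `alpha(γ,x)·f(x) = f(γ·x)` and
`beta(λ,y)·f⁻¹(y) = f⁻¹(λ·y)` almost everywhere. -/
structure OrbitEquivalenceCoupling (Γ : Type u) (Λ : Type v) [Group Γ] [Group Λ] where
  (X : Type)
  (Y : Type)
  [mX : MeasurableSpace X]
  [mY : MeasurableSpace Y]
  (sbX : StandardBorelSpace X)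
  (sbY : StandardBorelSpace Y)
  (μ : Measure X)
  (ν : Measure Y)
  (probμ : IsProbabilityMeasure μ)
  (probν : IsProbabilityMeasure ν)
  (actG : Γ → X → X)
  (actH : Λ → Y → Y)
  (actG_one : ∀ x, actG 1 x = x)
  (actG_mul : ∀ (g g' : Γ) (x : X), actG (g * g') x = actG g (actG g' x))
  (actH_one : ∀ y, actH 1 y = y)
  (actH_mul : ∀ (h h' : Λ) (y : Y), actH (h * h') y = actH h (actH h' y))
  (actG_meas : ∀ g : Γ, Measurable (actG g))
  (actH_meas : ∀ h : Λ, Measurable (actH h))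
  (actG_pres : ∀ g : Γ, MeasurePreserving (actG g) μ μ)
  (actH_pres : ∀ h : Λ, MeasurePreserving (actH h) ν ν)
  (actG_free : ∀ᵐ x ∂μ, ∀ g : Γ, actG g x = x → g = 1)
  (actH_free : ∀ᵐ y ∂ν, ∀ h : Λ, actH h y = y → h = 1)
  (f : MeasurableEquiv X Y)
  (f_pres : MeasurePreserving f μ ν)
  (orbit_eq : ∀ᵐ x ∂μ,
    {y : Y | ∃ g : Γ, f (actG g x) = y} = {y : Y | ∃ h : Λ, actH h (f x) = y})
  (alpha : Γ → X → Λ)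
  (beta : Λ → Y → Γ)
  (alpha_meas : ∀ (g : Γ) (h : Λ), MeasurableSet {x : X | alpha g x = h})
  (beta_meas : ∀ (h : Λ) (g : Γ), MeasurableSet {y : Y | beta h y = g})
  (alpha_spec : ∀ g : Γ, ∀ᵐ x ∂μ, actH (alpha g x) (f x) = f (actG g x))
  (beta_spec : ∀ h : Λ, ∀ᵐ y ∂ν, actG (beta h y) (f.symm y) = f.symm (actH h y))

attribute [instance] OrbitEquivalenceCoupling.mX OrbitEquivalenceCoupling.mY

section OrbitTransport

variable {G X : Type*} [Group G] [MeasurableSpace X] [MulAction G X] [MeasurableConstSMul G X]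

/-- A map which is piecewise given by group elements, on measurable pieces, is measurable. -/
lemma measurable_of_pieces [Countable G] {φ : X → X} (A : G → Set X)
    (hA : ∀ g, MeasurableSet (A g)) (hcov : ∀ x, ∃ g, x ∈ A g)
    (hφ : ∀ g, ∀ x ∈ A g, φ x = g • x) : Measurable φ := by
  intro B hB
  have : φ ⁻¹' B = ⋃ g, A g ∩ (fun x => g • x) ⁻¹' B := by
    ext x
    simp only [Set.mem_preimage, Set.mem_iUnion, Set.mem_inter_iff]
    constructor
    · intro hx
      obtain ⟨g, hg⟩ := hcov x
      exact ⟨g, hg, by rwa [← hφ g x hg]⟩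
    · rintro ⟨g, hg, hx⟩
      rwa [hφ g x hg]
  rw [this]
  exact .iUnion fun g => (hA g).inter (measurable_const_smul g hB)

/-- Mass transport: a measurable injection moving points inside their orbits does not increase
the measure. -/
lemma measure_le_of_injOn [Countable G] [StandardBorelSpace X] {μ : Measure X}
    [SMulInvariantMeasure G X μ] (hfree : ∀ (x : X) (g : G), g • x = x → g = 1)
    {φ : X → X} (hφ : Measurable φ) {A B : Set X} (hA : MeasurableSet A)
    (horb : ∀ x ∈ A, ∃ g : G, φ x = g • x) (hinj : Set.InjOn φ A) (hmaps : Set.MapsTo φ A B) :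
    μ A ≤ μ B := by
  set P : G → Set X := fun g => A ∩ {x | φ x = g • x} with hP
  have hPm : ∀ g, MeasurableSet (P g) := fun g =>
    hA.inter (measurableSet_eq_fun hφ (measurable_const_smul g))
  set Q : G → Set X := fun g => (fun x => g⁻¹ • x) ⁻¹' P g with hQ
  have hQm : ∀ g, MeasurableSet (Q g) := fun g => measurable_const_smul g⁻¹ (hPm g)
  have hQφ : ∀ g z, z ∈ Q g → φ (g⁻¹ • z) = z := by
    intro g z hz
    have := hz.2
    simpa using this
  have hdis : Pairwise (Function.onFun Disjoint Q) := by
    intro g h hgh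
    refine Set.disjoint_left.2 fun z hz hz' => hgh ?_
    have h1 : g⁻¹ • z = h⁻¹ • z :=
      hinj hz.1 hz'.1 ((hQφ g z hz).trans (hQφ h z hz').symm)
    have h2 : (h * g⁻¹) • z = z := by rw [mul_smul, h1, smul_inv_smul]
    exact (mul_inv_eq_one.1 (hfree z _ h2)).symm
  calc μ A ≤ μ (⋃ g, P g) := by
        refine measure_mono fun x hx => ?_
        obtain ⟨g, hg⟩ := horb x hx
        exact Set.mem_iUnion.2 ⟨g, hx, hg⟩
    _ ≤ ∑' g, μ (P g) := measure_iUnion_le _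
    _ = ∑' g, μ (Q g) := by
        congr 1; ext g; exact (measure_preimage_smul μ g⁻¹ (P g)).symm
    _ = μ (⋃ g, Q g) := (measure_iUnion hdis hQm).symm
    _ ≤ μ B := by
        refine measure_mono (Set.iUnion_subset fun g z hz => ?_)
        rw [← hQφ g z hz]
        exact hmaps hz.1

lemma card_mul_measureReal_le_one {μ : Measure X} [IsProbabilityMeasure μ]
    [SMulInvariantMeasure G X μ] {A : Set X} (hA : MeasurableSet A) (F : Finset G)
    (hF : ∀ g ∈ F, ∀ h ∈ F, ∀ x ∈ A, ∀ y ∈ A, g • x = h • y → g = h) :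
    (F.card : ℝ) * μ.real A ≤ 1 := by
  set Q : G → Set X := fun g => (fun x => g⁻¹ • x) ⁻¹' A with hQ
  have hdis : (F : Set G).PairwiseDisjoint Q := by
    intro g hg h hh hgh
    refine Set.disjoint_left.2 fun z hz hz' => hgh ?_
    exact hF g hg h hh _ hz _ hz' (by simp)
  have h1 : μ.real (⋃ g ∈ F, Q g) = ∑ g ∈ F, μ.real (Q g) :=
    measureReal_biUnion_finset hdis fun g _ => measurable_const_smul g⁻¹ hA
  have h2 : ∀ g ∈ F, μ.real (Q g) = μ.real A := fun g _ => by
    simp only [measureReal_def, hQ, measure_preimage_smul]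
  rw [Finset.sum_congr rfl h2, Finset.sum_const, nsmul_eq_mul] at h1
  rw [← h1]
  exact measureReal_le_one

/-- A measurable set meeting each orbit of an infinite group at most once is null. -/
lemma measure_eq_zero_of_partial_transversal [Infinite G] {μ : Measure X}
    [IsProbabilityMeasure μ] [SMulInvariantMeasure G X μ] {A : Set X} (hA : MeasurableSet A)
    (hfree : ∀ x ∈ A, ∀ g : G, g • x ∈ A → g = 1) : μ A = 0 := by
  rw [← measureReal_eq_zero_iff]
  by_contra hne
  have hpos : 0 < μ.real A := lt_of_le_of_ne measureReal_nonneg (Ne.symm hne)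
  obtain ⟨n, hn⟩ := exists_nat_gt (1 / μ.real A)
  obtain ⟨F, hF⟩ := Infinite.exists_subset_card_eq G n
  have := card_mul_measureReal_le_one (μ := μ) hA F (by
    intro g _ h _ x hx y hy hxy
    have : (h⁻¹ * g) • x = y := by rw [mul_smul, hxy, inv_smul_smul]
    have h1 := hfree x hx (h⁻¹ * g) (by rwa [this])
    exact (inv_mul_eq_one.1 h1).symm)
  rw [hF] at this
  rw [div_lt_iff₀ hpos] at hn
  linarith

end OrbitTransport

/-- A length function on a group whose balls of radius `n` have cardinality comparable to `n ^ r`. -/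
structure IsPolynomialLength {G : Type*} [Group G] (N : G → ℕ) (r : ℕ) (A : ℝ) : Prop where
  one : N 1 = 0
  mul_le : ∀ g h, N (g * h) ≤ N g + N h
  inv : ∀ g, N g⁻¹ = N g
  finite : ∀ n, {g | N g ≤ n}.Finite
  one_le : 1 ≤ A
  le_card : ∀ R : ℕ, 1 ≤ R → (R : ℝ) ^ r ≤ A * {g | N g ≤ R / 2}.ncard
  card_le : ∀ R : ℕ, 1 ≤ R → ({g | N g ≤ 8 * R}.ncard : ℝ) ≤ A * (R : ℝ) ^ r

section Separated

variable {G X : Type*} [Group G] [Countable G] [MeasurableSpace X] [MulAction G X]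
  [MeasurableConstSMul G X] {N : G → ℕ} {r : ℕ} {A : ℝ}

/-- Measurable maximal separated sets exist in the presence of a measurable function which is
injective on orbits. -/
lemma exists_measurable_separated_cover (hN : IsPolynomialLength N r A) {l : X → ℝ}
    (hl : Measurable l) (hinj : ∀ (x : X) (g : G), l (g • x) = l x → g = 1) (R : ℕ) :
    ∃ C : Set X, MeasurableSet C ∧ (∀ x ∈ C, ∀ g : G, g • x ∈ C → N g ≤ R → g = 1) ∧
      ∀ x, ∃ g : G, N g ≤ R ∧ g • x ∈ C := by
  obtain ⟨e, he⟩ := exists_surjective_nat (ℚ × ℚ)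
  let W : ℕ → Set X := fun n => l ⁻¹' Set.Ioo ((e n).1 : ℝ) ((e n).2 : ℝ)
  have hWm : ∀ n, MeasurableSet (W n) := fun n => hl measurableSet_Ioo
  let U : ℕ → Set X := fun n => W n ∩ ⋂ g : G, {x | g ≠ 1 → N g ≤ R → g • x ∉ W n}
  have hUm : ∀ n, MeasurableSet (U n) := by
    intro n
    refine (hWm n).inter (.iInter fun g => ?_)
    by_cases h : g ≠ 1 ∧ N g ≤ R
    · have : {x | g ≠ 1 → N g ≤ R → g • x ∉ W n} = ((fun x => g • x) ⁻¹' W n)ᶜ := by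
        ext x; simp [h.1, h.2]
      rw [this]
      exact (measurable_const_smul g (hWm n)).compl
    · have : {x | g ≠ 1 → N g ≤ R → g • x ∉ W n} = Set.univ := by
        ext x; simp only [Set.mem_ofPred_eq, Set.mem_univ, iff_true]; tauto
      rw [this]; exact .univ
  have hUcov : ∀ x, ∃ n, x ∈ U n := by
    intro x
    have hfin : ((fun g : G => l (g • x)) '' ({g | N g ≤ R} \ {1})).Finite :=
      ((hN.finite R).subset Set.sdiff_subset).image _
    have hnot : l x ∉ (fun g : G => l (g • x)) '' ({g | N g ≤ R} \ {1}) := by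
      rintro ⟨g, hg, hgx⟩
      exact hg.2 (hinj x g hgx)
    obtain ⟨ε, hε, hball⟩ := Metric.isOpen_iff.1 hfin.isClosed.isOpen_compl (l x) hnot
    obtain ⟨a, ha1, ha2⟩ := exists_rat_btwn (show l x - ε < l x by linarith)
    obtain ⟨b, hb1, hb2⟩ := exists_rat_btwn (show l x < l x + ε by linarith)
    obtain ⟨n, hn⟩ := he (a, b)
    refine ⟨n, ?_, Set.mem_iInter.2 fun g hg1 hgR hgW => ?_⟩
    · simp only [W, hn]; exact ⟨ha2, hb1⟩
    · simp only [W, hn] at hgW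
      have : l (g • x) ∈ Metric.ball (l x) ε := by
        rw [Metric.mem_ball, Real.dist_eq, abs_lt]
        constructor <;> linarith [hgW.1, hgW.2]
      exact hball this ⟨g, ⟨hgR, hg1⟩, rfl⟩
  let C : ℕ → Set X := fun n => Nat.rec ∅
    (fun n D => D ∪ (U n ∩ ⋂ g : G, {x | N g ≤ R → g • x ∉ D})) n
  have hCs : ∀ n, C (n + 1) = C n ∪ (U n ∩ ⋂ g : G, {x | N g ≤ R → g • x ∉ C n}) := fun n => rfl
  have hCm : ∀ n, MeasurableSet (C n) := by
    intro n
    induction n with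
    | zero => exact .empty
    | succ n ih =>
      rw [hCs]
      refine ih.union ((hUm n).inter (.iInter fun g => ?_))
      by_cases h : N g ≤ R
      · have : {x | N g ≤ R → g • x ∉ C n} = ((fun x => g • x) ⁻¹' C n)ᶜ := by
          ext x; simp [h]
        rw [this]
        exact (measurable_const_smul g ih).compl
      · simp [h]
  have hCsep : ∀ n, ∀ x ∈ C n, ∀ g : G, g • x ∈ C n → N g ≤ R → g = 1 := by
    intro n
    induction n with
    | zero => intro x hx; exact absurd hx (Set.notMem_empty x)
    | succ n ih =>
      intro x hx g hgx hg
      rw [hCs] at hx hgx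
      rcases hx with hx | ⟨hxU, hxC⟩
      · rcases hgx with hgx | ⟨_, hgxC⟩
        · exact ih x hx g hgx hg
        · exact absurd (by simpa using hx)
            (Set.mem_iInter.1 hgxC g⁻¹ (by rwa [hN.inv]))
      · rcases hgx with hgx | ⟨hgxU, _⟩
        · exact absurd hgx (Set.mem_iInter.1 hxC g hg)
        · by_contra hg1
          exact Set.mem_iInter.1 hxU.2 g hg1 hg hgxU.1
  have hCmono : Monotone C := monotone_nat_of_le_succ fun n => by
    rw [hCs]; exact Set.subset_union_left
  refine ⟨⋃ n, C n, .iUnion hCm, ?_, ?_⟩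
  · intro x hx g hgx hg
    obtain ⟨m, hm⟩ := Set.mem_iUnion.1 hx
    obtain ⟨n, hn⟩ := Set.mem_iUnion.1 hgx
    exact hCsep (max m n) x (hCmono (le_max_left _ _) hm) g (hCmono (le_max_right _ _) hn) hg
  · intro x
    obtain ⟨n, hn⟩ := hUcov x
    rcases em (∃ g : G, N g ≤ R ∧ g • x ∈ C n) with ⟨g, hg, hgx⟩ | h
    · exact ⟨g, hg, Set.mem_iUnion.2 ⟨n, hgx⟩⟩
    · refine ⟨1, by simp [hN.one], Set.mem_iUnion.2 ⟨n + 1, ?_⟩⟩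
      rw [hCs, one_smul]
      refine Or.inr ⟨hn, Set.mem_iInter.2 fun g hg hgx => h ⟨g, hg, hgx⟩⟩

end Separated

lemma sum_measureReal_le_of_card_le {X ι : Type*} [MeasurableSpace X] {μ : Measure X}
    [IsProbabilityMeasure μ] (I : Finset ι) (F : ι → Set X) (hF : ∀ i, MeasurableSet (F i))
    {E : Set X} (hE : MeasurableSet E) {c : ℝ} (hFE : ∀ i ∈ I, F i ⊆ E)
    (hc : ∀ x ∈ E, ({i | i ∈ I ∧ x ∈ F i}.ncard : ℝ) ≤ c) :
    ∑ i ∈ I, μ.real (F i) ≤ c * μ.real E := by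
  classical
  have hint : ∀ i ∈ I, Integrable ((F i).indicator (fun _ => (1 : ℝ))) μ := fun i _ =>
    (integrable_const 1).indicator (hF i)
  have h1 : ∑ i ∈ I, μ.real (F i) = ∫ x, ∑ i ∈ I, (F i).indicator (fun _ => (1 : ℝ)) x ∂μ := by
    rw [integral_finsetSum I hint]
    refine Finset.sum_congr rfl fun i _ => ?_
    rw [integral_indicator_const _ (hF i), smul_eq_mul, mul_one]
  have h2 : c * μ.real E = ∫ x, E.indicator (fun _ => c) x ∂μ := by
    rw [integral_indicator_const _ hE, smul_eq_mul, mul_comm]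
  rw [h1, h2]
  refine integral_mono (integrable_finsetSum I hint) ((integrable_const c).indicator hE) ?_
  intro x
  have h3 : ∑ i ∈ I, (F i).indicator (fun _ => (1 : ℝ)) x
      = ({i | i ∈ I ∧ x ∈ F i}.ncard : ℝ) := by
    have : {i | i ∈ I ∧ x ∈ F i} = ((I.filter fun i => x ∈ F i : Finset ι) : Set ι) := by
      ext; simp
    rw [this, Set.ncard_coe_finset]
    simp [Set.indicator_apply]
  by_cases hx : x ∈ E
  · simp only [h3, Set.indicator_of_mem hx]
    exact hc x hx
  · have : {i | i ∈ I ∧ x ∈ F i} = ∅ := by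
      ext i
      simp only [Set.mem_ofPred_eq, Set.mem_empty_iff_false, iff_false, not_and]
      exact fun hi hxi => hx (hFE i hi hxi)
    simp only [h3, this, Set.ncard_empty, Nat.cast_zero, Set.indicator_of_notMem hx, le_refl]

section Clustering

variable {G X : Type*} [Group G] [MulAction G X] {N : G → ℕ} {r : ℕ} {A : ℝ}

lemma IsPolynomialLength.le_of_card_mul_le (hN : IsPolynomialLength N r A) {R : ℕ} (hR : 1 ≤ R)
    {k : ℕ} (h : k * {g | N g ≤ R / 2}.ncard ≤ {g | N g ≤ 8 * R}.ncard) : (k : ℝ) ≤ A ^ 2 := by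
  have h1 := hN.le_card R hR
  have h2 := hN.card_le R hR
  have h3 : (k : ℝ) * {g | N g ≤ R / 2}.ncard ≤ {g | N g ≤ 8 * R}.ncard := by exact_mod_cast h
  have hpos : (0 : ℝ) < (R : ℝ) ^ r := by positivity
  have hA := hN.one_le
  refine le_of_mul_le_mul_right ?_ hpos
  calc (k : ℝ) * (R : ℝ) ^ r ≤ k * (A * {g | N g ≤ R / 2}.ncard) := by gcongr
    _ = A * (k * {g | N g ≤ R / 2}.ncard) := by ring
    _ ≤ A * (A * (R : ℝ) ^ r) := mul_le_mul_of_nonneg_left (h3.trans h2) (by linarith)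
    _ = A ^ 2 * (R : ℝ) ^ r := by ring

/-- The number of points of an `R`-separated set in a ball of radius `3R` is bounded. -/
lemma IsPolynomialLength.ncard_separated_le (hN : IsPolynomialLength N r A) {R : ℕ} (hR : 1 ≤ R)
    {C : Set X} (hsep : ∀ x ∈ C, ∀ g : G, g • x ∈ C → N g ≤ R → g = 1) (x : X) :
    ({g : G | N g ≤ 3 * R ∧ g • x ∈ C}.ncard : ℝ) ≤ A ^ 2 := by
  refine hN.le_of_card_mul_le hR ?_
  rw [← Set.ncard_prod]
  refine Set.ncard_le_ncard_of_injOn (fun q : G × G => q.2 * q.1) ?_ ?_ (hN.finite _)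
  · rintro ⟨g, h⟩ ⟨⟨hg, _⟩, hh⟩
    have := hN.mul_le h g
    simp only [Set.mem_ofPred_eq] at hg hh ⊢
    omega
  · rintro ⟨g, h⟩ ⟨⟨hg, hgC⟩, hh⟩ ⟨g', h'⟩ ⟨⟨hg', hgC'⟩, hh'⟩ heq
    simp only [Set.mem_ofPred_eq] at hg hh hg' hh' heq hgC hgC'
    have h1 : (h'⁻¹ * h) • g • x = g' • x := by
      rw [← mul_smul, mul_assoc, heq, inv_mul_cancel_left]
    have h2 : h'⁻¹ * h = 1 := by
      refine hsep _ hgC _ (by rwa [h1]) ?_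
      have := hN.mul_le h'⁻¹ h
      rw [hN.inv] at this
      omega
    have h3 : h = h' := (inv_mul_eq_one.1 h2).symm
    subst h3
    simp only [mul_right_inj] at heq
    rw [heq]

/-- The points of `C` at distance at most `n` from `x` in its orbit. -/
def visibleCenters (N : G → ℕ) (C : Set X) (n : ℕ) (x : X) : Set X :=
  {y | y ∈ C ∧ ∃ g : G, N g ≤ n ∧ g • x = y}

open Classical in
/-- The visible center of largest label. -/
noncomputable def chosenCenter (N : G → ℕ) (C : Set X) (l : X → ℝ) (n : ℕ) (x : X) : X :=
  if h : ∃ y ∈ visibleCenters N C n x, ∀ z ∈ visibleCenters N C n x, l z ≤ l y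
  then h.choose else x

lemma chosenCenter_congr {C : Set X} {l : X → ℝ} {n : ℕ} {x y : X}
    (hex : ∃ z ∈ visibleCenters N C n x, ∀ w ∈ visibleCenters N C n x, l w ≤ l z)
    (h : visibleCenters N C n x = visibleCenters N C n y) :
    chosenCenter N C l n x = chosenCenter N C l n y := by
  have hex' := hex
  rw [h] at hex'
  unfold chosenCenter
  rw [dif_pos hex, dif_pos hex']
  congr 1
  ext z
  rw [h]

lemma exists_max_visibleCenters (hN : IsPolynomialLength N r A) {R n : ℕ} (hn : R ≤ n) {C : Set X}
    (hcov : ∀ x, ∃ g : G, N g ≤ R ∧ g • x ∈ C) (l : X → ℝ) (x : X) :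
    ∃ y ∈ visibleCenters N C n x, ∀ z ∈ visibleCenters N C n x, l z ≤ l y := by
  refine Set.exists_max_image _ l ?_ ?_
  · refine ((hN.finite n).image fun g => g • x).subset ?_
    rintro y ⟨_, g, hg, rfl⟩
    exact ⟨g, hg, rfl⟩
  · obtain ⟨g, hg, hgx⟩ := hcov x
    exact ⟨g • x, hgx, g, hg.trans hn, rfl⟩

lemma chosenCenter_spec (hN : IsPolynomialLength N r A) {R n : ℕ} (hn : R ≤ n) {C : Set X}
    (hcov : ∀ x, ∃ g : G, N g ≤ R ∧ g • x ∈ C) (l : X → ℝ) (x : X) :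
    chosenCenter N C l n x ∈ visibleCenters N C n x ∧
      ∀ z ∈ visibleCenters N C n x, l z ≤ l (chosenCenter N C l n x) := by
  have h := exists_max_visibleCenters hN hn hcov l x
  unfold chosenCenter
  rw [dif_pos h]
  exact h.choose_spec

lemma measurable_chosenCenter [Countable G] [MeasurableSpace X] [MeasurableConstSMul G X]
    (hN : IsPolynomialLength N r A) {R n : ℕ} (hn : R ≤ n) {C : Set X} (hC : MeasurableSet C)
    (hcov : ∀ x, ∃ g : G, N g ≤ R ∧ g • x ∈ C) {l : X → ℝ}
    (hl : Measurable l) (hinj : ∀ (x : X) (g : G), l (g • x) = l x → g = 1) :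
    Measurable (chosenCenter N C l n) := by
  refine measurable_of_pieces (fun g : G => {x | N g ≤ n ∧ g • x ∈ C} ∩
    ⋂ h : G, {x | N h ≤ n → h • x ∈ C → l (h • x) ≤ l (g • x)}) (fun g => ?_) (fun x => ?_)
    (fun g x hx => ?_)
  · have hgC : MeasurableSet {x : X | g • x ∈ C} := measurable_const_smul g hC
    refine ((MeasurableSet.const _).inter hgC).inter (.iInter fun h => ?_)
    have h1 : MeasurableSet {x : X | h • x ∈ C} := measurable_const_smul h hC
    have h2 : MeasurableSet {x : X | l (h • x) ≤ l (g • x)} :=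
      measurableSet_le (hl.comp (measurable_const_smul h)) (hl.comp (measurable_const_smul g))
    exact (MeasurableSet.const _).imp (h1.imp h2)
  · obtain ⟨⟨hC', g, hg, hgx⟩, hmax⟩ := chosenCenter_spec hN hn hcov l x
    refine ⟨g, ⟨hg, hgx ▸ hC'⟩, Set.mem_iInter.2 fun h hh hhC => ?_⟩
    rw [hgx]
    exact hmax _ ⟨hhC, h, hh, rfl⟩
  · obtain ⟨⟨hC', h, hh, hhx⟩, hmax⟩ := chosenCenter_spec hN hn hcov l x
    have h1 : l (g • x) ≤ l (h • x) := by
      rw [hhx]; exact hmax _ ⟨hx.1.2, g, hx.1.1, rfl⟩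
    have h2 : l (h • x) ≤ l (g • x) := Set.mem_iInter.1 hx.2 h hh (hhx ▸ hC')
    have h3 := hinj (g • x) (h * g⁻¹) (by
      rw [← mul_smul, inv_mul_cancel_right]; exact le_antisymm h2 h1)
    rw [← hhx, mul_inv_eq_one.1 h3]

/-- Few radii separate two nearby points. -/
lemma ncard_separating_radii_le (hN : IsPolynomialLength N r A) {R Δ : ℕ} (hR : 1 ≤ R)
    (hΔ : Δ ≤ R) {C : Set X} (hsep : ∀ x ∈ C, ∀ g : G, g • x ∈ C → N g ≤ R → g = 1)
    (hcov : ∀ x, ∃ g : G, N g ≤ R ∧ g • x ∈ C) (l : X → ℝ) (u : X) (d : G) (hd : N d ≤ Δ) :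
    ({n | n ∈ Finset.Ico R (2 * R) ∧
      chosenCenter N C l n u ≠ chosenCenter N C l n (d • u)}.ncard : ℝ) ≤ A ^ 2 * Δ := by
  classical
  have hfin : {g : G | N g ≤ 3 * R ∧ g • u ∈ C}.Finite :=
    (hN.finite (3 * R)).subset fun g hg => hg.1
  set Γ := hfin.toFinset with hΓ
  let J : G → Finset ℕ := fun g =>
    Finset.Ico (N g) (N (g * d⁻¹)) ∪ Finset.Ico (N (g * d⁻¹)) (N g)
  have hJ : ∀ g, (J g).card ≤ Δ := by
    intro g
    have h1 := hN.mul_le g d⁻¹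
    have h2 := hN.mul_le (g * d⁻¹) d
    rw [inv_mul_cancel_right] at h2
    rw [hN.inv] at h1
    refine (Finset.card_union_le _ _).trans ?_
    simp only [Nat.card_Ico]
    omega
  have hsub : {n | n ∈ Finset.Ico R (2 * R) ∧
      chosenCenter N C l n u ≠ chosenCenter N C l n (d • u)} ⊆ (Γ.biUnion J : Finset ℕ) := by
    rintro n ⟨hn, hne⟩
    rw [Finset.mem_Ico] at hn
    by_contra hnot
    rw [Finset.mem_coe, Finset.mem_biUnion] at hnot
    push Not at hnot
    have key : ∀ g : G, g • u ∈ C → (N g ≤ n ↔ N (g * d⁻¹) ≤ n) := by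
      intro g hgC
      have h1 := hN.mul_le g d⁻¹
      have h2 := hN.mul_le (g * d⁻¹) d
      rw [inv_mul_cancel_right] at h2
      rw [hN.inv] at h1
      by_cases hg3 : N g ≤ 3 * R
      · have := hnot g (by rw [hΓ, Set.Finite.mem_toFinset]; exact ⟨hg3, hgC⟩)
        simp only [J, Finset.mem_union, Finset.mem_Ico] at this
        omega
      · omega
    refine hne (chosenCenter_congr (exists_max_visibleCenters hN hn.1 hcov l u) ?_)
    ext y
    constructor
    · rintro ⟨hy, g, hg, rfl⟩
      exact ⟨hy, g * d⁻¹, (key g hy).1 hg, by rw [← mul_smul, inv_mul_cancel_right]⟩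
    · rintro ⟨hy, g, hg, rfl⟩
      rw [← mul_smul] at hy ⊢
      exact ⟨hy, g * d, (key _ hy).2 (by rwa [mul_inv_cancel_right]), rfl⟩
  have hcard : {n | n ∈ Finset.Ico R (2 * R) ∧
      chosenCenter N C l n u ≠ chosenCenter N C l n (d • u)}.ncard ≤ Γ.card * Δ := by
    refine (Set.ncard_le_ncard hsub (Finset.finite_toSet _)).trans ?_
    rw [Set.ncard_coe_finset]
    exact Finset.card_biUnion_le_card_mul _ _ _ fun g _ => hJ g
  have hΓc : (Γ.card : ℝ) ≤ A ^ 2 := by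
    have := hN.ncard_separated_le hR hsep u
    rwa [Set.ncard_eq_toFinset_card _ hfin] at this
  calc _ ≤ ((Γ.card * Δ : ℕ) : ℝ) := by exact_mod_cast hcard
    _ = Γ.card * Δ := by push_cast; ring
    _ ≤ A ^ 2 * Δ := by gcongr

end Clustering

section Step

variable {G X : Type*} [Group G] [Countable G] [MeasurableSpace X] [StandardBorelSpace X]
  [MulAction G X] [MeasurableConstSMul G X] {N : G → ℕ} {r : ℕ} {A : ℝ}

/-- One step of the hierarchical clustering: the clusters given by the fibres of `p` are merged
into clusters of size about `R`, with control of the points separated from a neighbour. -/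
lemma exists_clustering_step {μ : Measure X} [IsProbabilityMeasure μ] [SMulInvariantMeasure G X μ]
    (hN : IsPolynomialLength N r A) {l : X → ℝ} (hl : Measurable l)
    (hinj : ∀ (x : X) (g : G), l (g • x) = l x → g = 1) (S : Finset G) (hS : ∀ s ∈ S, N s ≤ 1)
    {R D : ℕ} (hR : 1 ≤ R) (hDR : 2 * D + 1 ≤ R) {p : X → X} (hp : Measurable p)
    (hpD : ∀ x, ∃ g : G, N g ≤ D ∧ p x = g • x) :
    ∃ q : X → X, Measurable q ∧ (∀ x, ∃ g : G, N g ≤ 2 * R ∧ q x = g • x) ∧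
      (∃ C, MeasurableSet C ∧ (∀ x, q x ∈ C) ∧ μ.real C * (R : ℝ) ^ r ≤ A) ∧
      ∑ s ∈ S, μ.real {x | q (p x) ≠ q (p (s • x))} ≤
        A ^ 2 * (2 * D + 1) / R * ∑ s ∈ S, μ.real {x | p x ≠ p (s • x)} := by
  obtain ⟨C, hCm, hsep, hcov⟩ := exists_measurable_separated_cover hN hl hinj R
  have hqm : ∀ n, R ≤ n → Measurable (chosenCenter N C l n) := fun n hn =>
    measurable_chosenCenter hN hn hCm hcov hl hinj
  have hE : ∀ s : G, MeasurableSet {x | p x ≠ p (s • x)} := fun s =>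
    (measurableSet_eq_fun hp (hp.comp (measurable_const_smul s))).compl
  have hF : ∀ s : G, ∀ n, MeasurableSet
      {x | R ≤ n ∧ chosenCenter N C l n (p x) ≠ chosenCenter N C l n (p (s • x))} := by
    intro s n
    by_cases hn : R ≤ n
    · simp only [hn, true_and]
      exact (measurableSet_eq_fun ((hqm n hn).comp hp)
        ((hqm n hn).comp (hp.comp (measurable_const_smul s)))).compl
    · simp [hn]
  have hsum : ∀ s ∈ S, ∑ n ∈ Finset.Ico R (2 * R), μ.real
      {x | R ≤ n ∧ chosenCenter N C l n (p x) ≠ chosenCenter N C l n (p (s • x))} ≤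
      A ^ 2 * (2 * D + 1) * μ.real {x | p x ≠ p (s • x)} := by
    intro s hs
    refine sum_measureReal_le_of_card_le _ _ (hF s) (hE s) ?_ ?_
    · rintro n - x ⟨_, hx⟩ heq
      exact hx (by rw [heq])
    · intro x _
      obtain ⟨g, hg, hgx⟩ := hpD x
      obtain ⟨h, hh, hhx⟩ := hpD (s • x)
      have hd : p (s • x) = (h * s * g⁻¹) • p x := by
        rw [hhx, hgx, ← mul_smul, ← mul_smul, inv_mul_cancel_right]
      have hdN : N (h * s * g⁻¹) ≤ 2 * D + 1 := by
        have h1 := hN.mul_le (h * s) g⁻¹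
        have h2 := hN.mul_le h s
        have h3 := hS s hs
        rw [hN.inv] at h1
        omega
      have := ncard_separating_radii_le hN hR hDR hsep hcov l (p x) _ hdN
      rw [← hd] at this
      push_cast at this
      refine le_trans ?_ this
      gcongr
      · exact (Finset.finite_toSet (Finset.Ico R (2 * R))).subset fun n hn => hn.1
      · rintro hn
        exact hn.2
  have htot : ∑ n ∈ Finset.Ico R (2 * R), ∑ s ∈ S, μ.real
      {x | R ≤ n ∧ chosenCenter N C l n (p x) ≠ chosenCenter N C l n (p (s • x))} ≤
      ∑ n ∈ Finset.Ico R (2 * R),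
        A ^ 2 * (2 * D + 1) / R * ∑ s ∈ S, μ.real {x | p x ≠ p (s • x)} := by
    rw [Finset.sum_comm, Finset.sum_const, Nat.card_Ico, nsmul_eq_mul]
    have h2 : ((2 * R - R : ℕ) : ℝ) = R := by congr 1; omega
    have hR0 : (R : ℝ) ≠ 0 := by positivity
    rw [h2]
    calc _ ≤ ∑ s ∈ S, A ^ 2 * (2 * D + 1) * μ.real {x | p x ≠ p (s • x)} :=
          Finset.sum_le_sum hsum
      _ = _ := by rw [← Finset.mul_sum]; field_simp
  obtain ⟨n, hn, hle⟩ := Finset.exists_le_of_sum_le (Finset.nonempty_Ico.2 (by omega)) htot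
  rw [Finset.mem_Ico] at hn
  simp only [hn.1, true_and] at hle
  refine ⟨chosenCenter N C l n, hqm n hn.1, fun x => ?_, ⟨C, hCm, fun x => ?_, ?_⟩, hle⟩
  · obtain ⟨⟨_, g, hg, hgx⟩, _⟩ := chosenCenter_spec hN hn.1 hcov l x
    exact ⟨g, by omega, hgx.symm⟩
  · exact (chosenCenter_spec hN hn.1 hcov l x).1.1
  · have hfin := hN.finite (R / 2)
    have h1 := card_mul_measureReal_le_one (μ := μ) hCm hfin.toFinset (by
      intro g hg h hh x hx y hy hxy
      rw [Set.Finite.mem_toFinset, Set.mem_ofPred_eq] at hg hh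
      have h2 : (h⁻¹ * g) • x = y := by rw [mul_smul, hxy, inv_smul_smul]
      have h3 := hN.mul_le h⁻¹ g
      rw [hN.inv] at h3
      exact (inv_mul_eq_one.1 (hsep x hx _ (by rwa [h2]) (by omega))).symm)
    rw [← Set.ncard_eq_toFinset_card _ hfin] at h1
    have h2 := hN.le_card R hR
    have hA := hN.one_le
    calc μ.real C * (R : ℝ) ^ r ≤ μ.real C * (A * {g | N g ≤ R / 2}.ncard) := by gcongr
      _ = A * ({g | N g ≤ R / 2}.ncard * μ.real C) := by ring
      _ ≤ A * 1 := by gcongr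
      _ = A := mul_one A

end Step

/-- The superexponential scales of the hierarchical clustering. -/
def clusterScale (j : ℕ) : ℕ := 2 ^ (j * (j + 4))

lemma clusterScale_zero : clusterScale 0 = 1 := rfl

lemma clusterScale_pos (j : ℕ) : 1 ≤ clusterScale j := Nat.one_le_two_pow

lemma clusterScale_succ (j : ℕ) : clusterScale (j + 1) = clusterScale j * 2 ^ (2 * j + 5) := by
  unfold clusterScale
  rw [← pow_add]
  congr 1
  ring

lemma nine_mul_clusterScale_le (j : ℕ) : 9 * clusterScale j ≤ clusterScale (j + 1) := by
  rw [clusterScale_succ, mul_comm]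
  refine Nat.mul_le_mul_left _ ?_
  calc 9 ≤ 2 ^ 5 := by norm_num
    _ ≤ 2 ^ (2 * j + 5) := Nat.pow_le_pow_right (by norm_num) (by omega)

/-- A sequence of coarser and coarser measurable clusterings of the orbits of an action. -/
structure ClusterHierarchy {G X : Type*} [Group G] [MeasurableSpace X] [MulAction G X]
    (N : G → ℕ) (r : ℕ) (A B : ℝ) (μ : Measure X) (p : ℕ → X → X) : Prop where
  zero : p 0 = id
  measurable : ∀ j, Measurable (p j)
  exists_smul : ∀ j x, ∃ g : G, N g ≤ 4 * clusterScale j ∧ p j x = g • x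
  refines : ∀ j x y, p j x = p j y → p (j + 1) x = p (j + 1) y
  range : ∀ j, ∃ C, MeasurableSet C ∧ (∀ x, p j x ∈ C) ∧ μ.real C * (clusterScale j : ℝ) ^ r ≤ A
  separated : ∀ g : G, ∃ c : ℝ, 0 ≤ c ∧ ∀ j,
    μ.real {x | p j x ≠ p j (g • x)} * clusterScale j ≤ c * B ^ j

lemma exists_clusterHierarchy {G X : Type*} [Group G] [Countable G] [MeasurableSpace X]
    [StandardBorelSpace X] [MulAction G X] [MeasurableConstSMul G X] {N : G → ℕ} {r : ℕ} {A : ℝ}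
    {μ : Measure X} [IsProbabilityMeasure μ] [SMulInvariantMeasure G X μ]
    (hN : IsPolynomialLength N r A) {l : X → ℝ} (hl : Measurable l)
    (hinj : ∀ (x : X) (g : G), l (g • x) = l x → g = 1) (S : Finset G) (hS : ∀ s ∈ S, N s ≤ 1)
    (hgen : Subgroup.closure (S : Set G) = ⊤) :
    ∃ p : ℕ → X → X, ClusterHierarchy (G := G) N r A (9 * A ^ 2) μ p := by
  let Good : ℕ → (X → X) → Prop := fun j p =>
    Measurable p ∧ ∀ x, ∃ g : G, N g ≤ 4 * clusterScale j ∧ p x = g • x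
  let e : (X → X) → ℝ := fun p => ∑ s ∈ S, μ.real {x | p x ≠ p (s • x)}
  have he : ∀ p, 0 ≤ e p := fun p => Finset.sum_nonneg fun _ _ => measureReal_nonneg
  have step : ∀ j (p : {p // Good j p}), ∃ p' : {p // Good (j + 1) p},
      (∀ x y, p.1 x = p.1 y → p'.1 x = p'.1 y) ∧
      (∃ C, MeasurableSet C ∧ (∀ x, p'.1 x ∈ C) ∧
        μ.real C * (clusterScale (j + 1) : ℝ) ^ r ≤ A) ∧
      e p'.1 * clusterScale (j + 1) ≤ 9 * A ^ 2 * (e p.1 * clusterScale j) := by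
    rintro j ⟨p, hpm, hp⟩
    have h9 := nine_mul_clusterScale_le j
    have h1 := clusterScale_pos j
    obtain ⟨q, hqm, hq, ⟨C, hC, hqC, hCμ⟩, hsep⟩ := exists_clustering_step (μ := μ) hN hl hinj S hS
      (clusterScale_pos (j + 1)) (D := 4 * clusterScale j) (by omega) hpm hp
    refine ⟨⟨q ∘ p, hqm.comp hpm, fun x => ?_⟩, fun x y hxy => congrArg q hxy,
      ⟨C, hC, fun x => hqC _, hCμ⟩, ?_⟩
    · obtain ⟨g, hg, hgx⟩ := hp x
      obtain ⟨h, hh, hhx⟩ := hq (p x)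
      refine ⟨h * g, ?_, by rw [Function.comp_apply, hhx, hgx, mul_smul]⟩
      have := hN.mul_le h g
      omega
    · have hpos : (0 : ℝ) < clusterScale (j + 1) := by
        exact_mod_cast clusterScale_pos (j + 1)
      have hpos' : (1 : ℝ) ≤ clusterScale j := by exact_mod_cast h1
      push_cast at hsep
      calc e (q ∘ p) * clusterScale (j + 1)
          ≤ (A ^ 2 * (2 * (4 * clusterScale j) + 1) / clusterScale (j + 1) * e p)
            * clusterScale (j + 1) := by gcongr; exact hsep
        _ = A ^ 2 * (2 * (4 * clusterScale j) + 1) * e p := by field_simp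
        _ ≤ A ^ 2 * (9 * clusterScale j) * e p := by
            have := he p
            gcongr
            linarith
        _ = _ := by ring
  choose nxt hnxt using step
  have hid : Good 0 id := ⟨measurable_id, fun x => ⟨1, by simp [hN.one], by simp⟩⟩
  let P : ∀ j, {p // Good j p} := fun j => Nat.rec ⟨id, hid⟩ (fun j p => nxt j p) j
  have hP : ∀ j, P (j + 1) = nxt j (P j) := fun j => rfl
  have hA := hN.one_le
  have hEj : ∀ j, e (P j).1 * clusterScale j ≤ e id * (9 * A ^ 2) ^ j := by
    intro j
    induction j with
    | zero => simp [P, clusterScale_zero]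
    | succ j ih =>
      calc _ ≤ 9 * A ^ 2 * (e (P j).1 * clusterScale j) := by rw [hP]; exact (hnxt j (P j)).2.2
        _ ≤ 9 * A ^ 2 * (e id * (9 * A ^ 2) ^ j) := by gcongr
        _ = _ := by ring
  refine ⟨fun j => (P j).1, rfl, fun j => (P j).2.1, fun j => (P j).2.2,
    fun j x y h => ?_, fun j => ?_, fun g => ?_⟩
  · exact (hnxt j (P j)).1 x y h
  · cases j with
    | zero => exact ⟨Set.univ, .univ, fun _ => Set.mem_univ _, by simpa [clusterScale_zero] using hA⟩
    | succ j => exact (hnxt j (P j)).2.1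
  · have hm : g ∈ Subgroup.closure (S : Set G) := hgen ▸ Subgroup.mem_top g
    induction hm using Subgroup.closure_induction with
    | mem s hs =>
      refine ⟨e id, he _, fun j => le_trans ?_ (hEj j)⟩
      gcongr
      exact Finset.single_le_sum (f := fun s => μ.real {x | (P j).1 x ≠ (P j).1 (s • x)})
        (fun _ _ => measureReal_nonneg) hs
    | one => exact ⟨0, le_rfl, fun j => by simp⟩
    | mul g h _ _ ihg ihh =>
      obtain ⟨c, hc, hcj⟩ := ihg
      obtain ⟨d, hd, hdj⟩ := ihh
      refine ⟨c + d, by positivity, fun j => ?_⟩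
      have hsub : {x | (P j).1 x ≠ (P j).1 ((g * h) • x)} ⊆
          {x | (P j).1 x ≠ (P j).1 (h • x)} ∪
            (fun x => h • x) ⁻¹' {x | (P j).1 x ≠ (P j).1 (g • x)} := by
        intro x hx
        simp only [Set.mem_union, Set.mem_preimage, Set.mem_ofPred_eq] at hx ⊢
        by_contra! hcon
        exact hx (by rw [mul_smul, hcon.1, hcon.2])
      have hle : μ.real {x | (P j).1 x ≠ (P j).1 ((g * h) • x)} ≤
          μ.real {x | (P j).1 x ≠ (P j).1 (h • x)} + μ.real {x | (P j).1 x ≠ (P j).1 (g • x)} := by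
        refine (measureReal_mono hsub).trans ((measureReal_union_le _ _).trans (le_of_eq ?_))
        rw [measureReal_def, measureReal_def, measureReal_def, measure_preimage_smul]
      calc _ ≤ (μ.real {x | (P j).1 x ≠ (P j).1 (h • x)} +
            μ.real {x | (P j).1 x ≠ (P j).1 (g • x)}) * clusterScale j := by gcongr
        _ ≤ _ := by linarith [hcj j, hdj j]
    | inv g _ ih =>
      obtain ⟨c, hc, hcj⟩ := ih
      refine ⟨c, hc, fun j => le_trans (le_of_eq ?_) (hcj j)⟩
      congr 1
      rw [measureReal_def, measureReal_def,
        ← measure_preimage_smul μ g {x | (P j).1 x ≠ (P j).1 (g⁻¹ • x)}]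
      congr 2
      ext x
      simp [ne_comm]

section Index

variable {X : Type*}

/-- The position of a point inside its cluster of level `j`, where the clusters of level `i` inside
a cluster of level `i + 1` are ordered by the labels of their centers. -/
noncomputable def clusterIndex (p : ℕ → X → X) (l : X → ℝ) : ℕ → X → ℕ
  | 0, _ => 0
  | j + 1, x => clusterIndex p l j x + {y | p (j + 1) y = p (j + 1) x ∧ l (p j y) < l (p j x)}.ncard

/-- The number of points in the cluster of level `j` of a point. -/
noncomputable def clusterCard (p : ℕ → X → X) (j : ℕ) (x : X) : ℕ := {y | p j y = p j x}.ncard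

lemma ncard_add_clusterCard_le (p : ℕ → X → X) (j : ℕ) {x : X} {F : Set X} (hF : F.Finite) (T : Set X)
    (hT : T ⊆ F) (hx : {y | p j y = p j x} ⊆ F) (hdis : ∀ y ∈ T, p j y ≠ p j x) :
    T.ncard + clusterCard p j x ≤ F.ncard := by
  unfold clusterCard
  have hd : Disjoint T {y | p j y = p j x} := Set.disjoint_left.2 fun y hy hy' => hdis y hy hy'
  rw [← Set.ncard_union_eq hd (hF.subset hT) (hF.subset hx)]
  exact Set.ncard_le_ncard (Set.union_subset hT hx) hF

/-- Nested finite clusters, such that merged centers have distinct labels. -/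
structure IsLabelledHierarchy (p : ℕ → X → X) (l : X → ℝ) : Prop where
  zero : p 0 = id
  finite : ∀ j x, {y | p j y = p j x}.Finite
  refines : ∀ j x y, p j x = p j y → p (j + 1) x = p (j + 1) y
  label : ∀ j x y, p (j + 1) x = p (j + 1) y → l (p j x) = l (p j y) → p j x = p j y

lemma clusterIndex_mono {X : Type*} (p : ℕ → X → X) (l : X → ℝ) (x : X) :
    Monotone fun j => clusterIndex p l j x :=
  monotone_nat_of_le_succ fun j => by simp only [clusterIndex]; omega

namespace IsLabelledHierarchy

variable {p : ℕ → X → X} {l : X → ℝ} (h : IsLabelledHierarchy p l)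
include h

lemma refines_le {i j : ℕ} (hij : i ≤ j) {x y : X} (hxy : p i x = p i y) : p j x = p j y := by
  induction j, hij using Nat.le_induction with
  | base => exact hxy
  | succ j _ ih => exact h.refines j x y ih

lemma clusterIndex_succ_add_clusterCard_le (j : ℕ) (x : X) :
    clusterIndex p l (j + 1) x + clusterCard p j x ≤
      clusterIndex p l j x + clusterCard p (j + 1) x := by
  have := ncard_add_clusterCard_le p j (h.finite (j + 1) x)
    {y | p (j + 1) y = p (j + 1) x ∧ l (p j y) < l (p j x)} (fun y hy => hy.1)
    (fun y hy => h.refines j y x hy) (fun y hy heq => by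
      have := hy.2
      rw [heq] at this
      exact lt_irrefl _ this)
  simp only [clusterIndex]
  change _ + _ ≤ clusterCard p (j + 1) x at this
  omega

lemma clusterIndex_lt_clusterCard (j : ℕ) (x : X) : clusterIndex p l j x < clusterCard p j x := by
  induction j with
  | zero =>
    simp only [clusterIndex, clusterCard, h.zero, id]
    exact (Set.ncard_pos (by simp)).2 ⟨x, rfl⟩
  | succ j ih =>
    have := h.clusterIndex_succ_add_clusterCard_le j x
    omega

lemma clusterCard_sub_clusterIndex_mono (x : X) :
    Monotone fun j => clusterCard p j x - clusterIndex p l j x :=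
  monotone_nat_of_le_succ fun j => by
    have h1 := h.clusterIndex_succ_add_clusterCard_le j x
    have h2 := h.clusterIndex_lt_clusterCard j x
    have h3 := h.clusterIndex_lt_clusterCard (j + 1) x
    omega

lemma clusterIndex_injective (j : ℕ) {x y : X} (hxy : p j x = p j y)
    (hi : clusterIndex p l j x = clusterIndex p l j y) : x = y := by
  induction j generalizing x y with
  | zero => simpa [h.zero] using hxy
  | succ j ih =>
    have key : ∀ u v : X, p (j + 1) u = p (j + 1) v → l (p j u) < l (p j v) →
        clusterIndex p l (j + 1) u < clusterIndex p l (j + 1) v := by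
      intro u v huv hl
      have h1 := ncard_add_clusterCard_le p j (x := u)
        (F := {y | p (j + 1) y = p (j + 1) v ∧ l (p j y) < l (p j v)})
        ((h.finite (j + 1) v).subset fun y hy => hy.1)
        {y | p (j + 1) y = p (j + 1) u ∧ l (p j y) < l (p j u)}
        (fun y hy => ⟨hy.1.trans huv, hy.2.trans hl⟩)
        (fun y hy => ⟨(h.refines j y u hy).trans huv, by rw [show p j y = p j u from hy]; exact hl⟩)
        (fun y hy heq => by
          have := hy.2
          rw [heq] at this
          exact lt_irrefl _ this)
      have h2 := h.clusterIndex_lt_clusterCard j u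
      simp only [clusterIndex]
      omega
    rcases lt_trichotomy (l (p j x)) (l (p j y)) with hlt | heq | hgt
    · exact absurd hi (key x y hxy hlt).ne
    · have hp := h.label j x y hxy heq
      refine ih hp ?_
      simp only [clusterIndex] at hi
      rw [hxy, hp] at hi
      omega
    · exact absurd hi (key y x hxy.symm hgt).ne'

lemma exists_clusterIndex_eq (j : ℕ) (x : X) {n : ℕ} (hn : n < clusterCard p j x) :
    ∃ y, p j y = p j x ∧ clusterIndex p l j y = n := by
  have himg : clusterIndex p l j '' {y | p j y = p j x} = Set.Iio (clusterCard p j x) := by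
    refine Set.eq_of_subset_of_ncard_le ?_ ?_ (Set.finite_Iio _)
    · rintro _ ⟨y, hy, rfl⟩
      have := h.clusterIndex_lt_clusterCard j y
      rw [clusterCard, show p j y = p j x from hy] at this
      exact this
    · have hinj : Set.InjOn (clusterIndex p l j) {y | p j y = p j x} := fun y hy z hz hyz =>
        h.clusterIndex_injective j (Eq.trans hy (Eq.symm hz)) hyz
      rw [hinj.ncard_image, ← Finset.coe_Iio, Set.ncard_coe_finset, Nat.card_Iio, clusterCard]
  have : n ∈ clusterIndex p l j '' {y | p j y = p j x} := himg ▸ hn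
  obtain ⟨y, hy, hyn⟩ := this
  exact ⟨y, hy, hyn⟩

lemma clusterIndex_sub_eq {i j : ℕ} {x y : X} (hi : p i x = p i y) (hj : p j x = p j y) :
    (clusterIndex p l i y : ℤ) - clusterIndex p l i x =
      clusterIndex p l j y - clusterIndex p l j x := by
  wlog hij : i ≤ j generalizing i j
  · exact (this hj hi (le_of_not_ge hij)).symm
  induction j, hij using Nat.le_induction with
  | base => rfl
  | succ j hij ih =>
    rw [ih (h.refines_le hij hi)]
    simp only [clusterIndex]
    rw [hj, h.refines_le hij hi]
    push_cast
    ring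

end IsLabelledHierarchy

open Classical in
/-- The signed number of steps from `x` to `y` in the ordering given by the cluster indices. -/
noncomputable def clusterOffset (p : ℕ → X → X) (l : X → ℝ) (x y : X) : ℤ :=
  if h : ∃ j, p j x = p j y then clusterIndex p l h.choose y - clusterIndex p l h.choose x else 0

lemma IsLabelledHierarchy.clusterOffset_eq {p : ℕ → X → X} {l : X → ℝ}
    (h : IsLabelledHierarchy p l) {j : ℕ} {x y : X} (hj : p j x = p j y) :
    clusterOffset p l x y = clusterIndex p l j y - clusterIndex p l j x := by
  have hex : ∃ j, p j x = p j y := ⟨j, hj⟩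
  rw [clusterOffset, dif_pos hex]
  exact h.clusterIndex_sub_eq hex.choose_spec hj

end Index

lemma summable_clusterScale {B a c : ℝ} (hB : 0 < B) (hac : a < c) :
    Summable fun j : ℕ => B ^ j * (clusterScale (j + 1) : ℝ) ^ a / (clusterScale j : ℝ) ^ c := by
  have hs : ∀ j : ℕ, (0 : ℝ) < clusterScale j := fun j => by exact_mod_cast clusterScale_pos j
  have hq : ∀ (j : ℕ) (t : ℝ), (clusterScale (j + 1) : ℝ) ^ t =
      (clusterScale j : ℝ) ^ t * (2 : ℝ) ^ (t * (2 * j + 5)) := by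
    intro j t
    rw [clusterScale_succ]
    push_cast
    rw [Real.mul_rpow (hs j).le (by positivity), ← Real.rpow_natCast, ← Real.rpow_mul (by norm_num)]
    push_cast
    ring_nf
  refine summable_of_ratio_test_tendsto_lt_one (l := 0) one_pos (.of_forall fun j => ?_) ?_
  · have := hs j
    have := hs (j + 1)
    positivity
  · have heq : (fun j : ℕ => ‖B ^ (j + 1) * (clusterScale (j + 1 + 1) : ℝ) ^ a /
        (clusterScale (j + 1) : ℝ) ^ c‖ /
        ‖B ^ j * (clusterScale (j + 1) : ℝ) ^ a / (clusterScale j : ℝ) ^ c‖) =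
        fun j : ℕ => (B * 2 ^ (7 * a - 5 * c)) * ((2 : ℝ) ^ (2 * (a - c))) ^ j := by
      funext j
      have h0 := hs j
      have h1 := hs (j + 1)
      have h2 := hs (j + 1 + 1)
      rw [Real.norm_of_nonneg (by positivity), Real.norm_of_nonneg (by positivity)]
      have e1 := hq (j + 1) a
      have e2 := hq j c
      have e3 : (2 : ℝ) ^ (a * (2 * ((j + 1 : ℕ) : ℝ) + 5)) =
          2 ^ (7 * a - 5 * c) * ((2 : ℝ) ^ (2 * (a - c))) ^ j * 2 ^ (c * (2 * (j : ℝ) + 5)) := by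
        rw [← Real.rpow_natCast, ← Real.rpow_mul (by norm_num), ← Real.rpow_add (by norm_num),
          ← Real.rpow_add (by norm_num)]
        push_cast
        ring_nf
      rw [e1, e3, e2]
      have p1 : (0 : ℝ) < (clusterScale (j + 1) : ℝ) ^ a := by positivity
      have p2 : (0 : ℝ) < (clusterScale j : ℝ) ^ c := by positivity
      have p3 : (0 : ℝ) < (2 : ℝ) ^ (c * (2 * (j : ℝ) + 5)) := by positivity
      field_simp
      ring
    rw [heq, ← mul_zero (B * 2 ^ (7 * a - 5 * c) : ℝ)]
    refine (tendsto_pow_atTop_nhds_zero_of_lt_one (by positivity) ?_).const_mul _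
    exact Real.rpow_lt_one_of_one_lt_of_neg (by norm_num) (by linarith)

lemma exists_eventually_eq_of_monotone_of_bounded {f : ℕ → ℕ} (hf : Monotone f) {n : ℕ}
    (hn : ∀ j, f j ≤ n) : ∃ m i, ∀ j, i ≤ j → f j = m := by
  have hb : BddAbove (Set.range f) := ⟨n, by rintro _ ⟨j, rfl⟩; exact hn j⟩
  obtain ⟨i, hi⟩ := Nat.sSup_mem (Set.range_nonempty f) hb
  exact ⟨_, i, fun j hij => le_antisymm (le_csSup hb ⟨j, rfl⟩) (hi ▸ hf hij)⟩

lemma measurable_ncard_of_orbit {G X : Type*} [Group G] [MeasurableSpace X] [MulAction G X]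
    (hfree : ∀ (x : X) (g : G), g • x = x → g = 1) (T : X → Set X) (F : Finset G)
    (hT : ∀ g : G, MeasurableSet {x | g • x ∈ T x}) (hF : ∀ x, ∀ y ∈ T x, ∃ g ∈ F, y = g • x) :
    Measurable fun x => (T x).ncard := by
  classical
  have heq : (fun x => (T x).ncard) =
      fun x => ∑ g ∈ F, {x | g • x ∈ T x}.indicator (fun _ => 1) x := by
    funext x
    have h1 : T x = (fun g : G => g • x) '' ((F.filter fun g => g • x ∈ T x : Finset G) : Set G) := by
      ext y
      simp only [Finset.coe_filter, Set.mem_image, Set.mem_ofPred_eq]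
      constructor
      · intro hy
        obtain ⟨g, hg, rfl⟩ := hF x y hy
        exact ⟨g, ⟨hg, hy⟩, rfl⟩
      · rintro ⟨g, ⟨_, hg⟩, rfl⟩
        exact hg
    have h2 : Function.Injective fun g : G => g • x := fun g h hgh => by
      have : (h⁻¹ * g) • x = x := by
        rw [mul_smul, show g • x = h • x from hgh, inv_smul_smul]
      exact (inv_mul_eq_one.1 (hfree x _ this)).symm
    rw [h1, Set.ncard_image_of_injective _ h2, Set.ncard_coe_finset, Finset.card_filter]
    refine Finset.sum_congr rfl fun g _ => ?_
    simp [Set.indicator_apply]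
  rw [heq]
  exact Finset.measurable_sum _ fun g _ => measurable_const.indicator (hT g)

lemma smul_eq_of_label {G X : Type*} [Group G] [MulAction G X] {l : X → ℝ}
    (hinj : ∀ (x : X) (g : G), l (g • x) = l x → g = 1) (x : X) (g : G)
    (h : g • x = x) : g = 1 := hinj x g (by rw [h])

section GoodSet

variable {G X : Type*} [Group G] [MeasurableSpace X] [MulAction G X]
  {N : G → ℕ} {r : ℕ} {A B : ℝ} {μ : Measure X} {p : ℕ → X → X} {l : X → ℝ}

/-- The points in whose orbit all points end up in a common cluster, in which they are arbitrarily
far from both ends. -/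
def clusterGoodSet (G : Type*) {X : Type*} [Group G] [MulAction G X] (p : ℕ → X → X) (l : X → ℝ) :
    Set X :=
  {x | (∀ g : G, ∃ j, p j x = p j (g • x)) ∧ (∀ n, ∃ j, n < clusterIndex p l j x) ∧
    ∀ n, ∃ j, n < clusterCard p j x - clusterIndex p l j x}

namespace ClusterHierarchy

lemma exists_smul_of_eq (H : ClusterHierarchy N r A B μ p) (hN : IsPolynomialLength N r A) {j : ℕ}
    {x y : X} (h : p j y = p j x) : ∃ g : G, N g ≤ 8 * clusterScale j ∧ y = g • x := by
  obtain ⟨a, ha, hax⟩ := H.exists_smul j x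
  obtain ⟨b, hb, hby⟩ := H.exists_smul j y
  refine ⟨b⁻¹ * a, ?_, ?_⟩
  · have := hN.mul_le b⁻¹ a
    rw [hN.inv] at this
    omega
  · rw [mul_smul, ← hax, ← h, hby, inv_smul_smul]

lemma isLabelledHierarchy (H : ClusterHierarchy N r A B μ p) (hN : IsPolynomialLength N r A)
    (hinj : ∀ (x : X) (g : G), l (g • x) = l x → g = 1) : IsLabelledHierarchy p l where
  zero := H.zero
  finite j x := by
    refine ((hN.finite (8 * clusterScale j)).image fun g => g • x).subset fun y hy => ?_
    obtain ⟨g, hg, hgy⟩ := H.exists_smul_of_eq hN hy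
    exact ⟨g, hg, hgy.symm⟩
  refines := H.refines
  label j x y hxy hl := by
    obtain ⟨g, _, rfl⟩ := H.exists_smul_of_eq hN hxy.symm
    obtain ⟨a, _, ha⟩ := H.exists_smul j x
    obtain ⟨b, _, hb⟩ := H.exists_smul j (g • x)
    have h1 : p j (g • x) = (b * g * a⁻¹) • p j x := by
      rw [hb, ha, ← mul_smul, ← mul_smul, inv_mul_cancel_right]
    rw [h1] at hl
    rw [h1, hinj _ _ hl.symm, one_smul]

lemma clusterCard_le (H : ClusterHierarchy N r A B μ p) (hN : IsPolynomialLength N r A)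
    (j : ℕ) (x : X) : (clusterCard p j x : ℝ) ≤ A * (clusterScale j : ℝ) ^ r := by
  refine le_trans ?_ (hN.card_le _ (clusterScale_pos j))
  have hfin := hN.finite (8 * clusterScale j)
  have hsub : {y | p j y = p j x} ⊆ (fun g => g • x) '' {g | N g ≤ 8 * clusterScale j} := by
    intro y hy
    obtain ⟨g, hg, hgy⟩ := H.exists_smul_of_eq hN hy
    exact ⟨g, hg, hgy.symm⟩
  exact_mod_cast (Set.ncard_le_ncard hsub (hfin.image _)).trans (Set.ncard_image_le hfin)

section Measurability

variable [StandardBorelSpace X] [MeasurableConstSMul G X] (H : ClusterHierarchy N r A B μ p)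
  (hN : IsPolynomialLength N r A) (hl : Measurable l)
  (hinj : ∀ (x : X) (g : G), l (g • x) = l x → g = 1)
include H hN hinj

lemma measurable_clusterCard (j : ℕ) : Measurable (clusterCard p j) := by
  refine measurable_ncard_of_orbit (smul_eq_of_label hinj) (fun x => {y | p j y = p j x})
    (hN.finite (8 * clusterScale j)).toFinset (fun g => ?_) (fun x y hy => ?_)
  · exact measurableSet_eq_fun ((H.measurable j).comp (measurable_const_smul g)) (H.measurable j)
  · obtain ⟨g, hg, hgy⟩ := H.exists_smul_of_eq hN hy
    exact ⟨g, by simpa using hg, hgy⟩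

include hl in
lemma measurable_clusterIndex (j : ℕ) : Measurable (clusterIndex p l j) := by
  induction j with
  | zero => exact measurable_const
  | succ j ih =>
    refine ih.add (measurable_ncard_of_orbit (smul_eq_of_label hinj)
      (fun x => {y | p (j + 1) y = p (j + 1) x ∧ l (p j y) < l (p j x)})
      (hN.finite (8 * clusterScale (j + 1))).toFinset (fun g => ?_) (fun x y hy => ?_))
    · have hlp := hl.comp (H.measurable j)
      exact (measurableSet_eq_fun ((H.measurable (j + 1)).comp (measurable_const_smul g))
        (H.measurable (j + 1))).inter
        (measurableSet_lt (hlp.comp (measurable_const_smul g)) hlp)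
    · obtain ⟨g, hg, hgy⟩ := H.exists_smul_of_eq hN hy.1
      exact ⟨g, by simpa using hg, hgy⟩

omit hN hinj in
lemma measurableSet_merging [Countable G] :
    MeasurableSet {x | ∀ g : G, ∃ j, p j x = p j (g • x)} := by
  have : {x | ∀ g : G, ∃ j, p j x = p j (g • x)} = ⋂ g : G, ⋃ j, {x | p j x = p j (g • x)} := by
    ext; simp
  rw [this]
  exact .iInter fun g => .iUnion fun j =>
    measurableSet_eq_fun (H.measurable j) ((H.measurable j).comp (measurable_const_smul g))

include hl in
lemma measurableSet_clusterGoodSet [Countable G] : MeasurableSet (clusterGoodSet G p l) := by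
  have hI := H.measurable_clusterIndex hN hl hinj
  have hC := H.measurable_clusterCard hN hinj
  have : clusterGoodSet G p l = {x | ∀ g : G, ∃ j, p j x = p j (g • x)} ∩
      ((⋂ n, ⋃ j, {x | n < clusterIndex p l j x}) ∩
        ⋂ n, ⋃ j, {x | n < clusterCard p j x - clusterIndex p l j x}) := by
    ext; simp [clusterGoodSet]
  rw [this]
  refine H.measurableSet_merging.inter ((MeasurableSet.iInter fun n => .iUnion fun j => ?_).inter
    (.iInter fun n => .iUnion fun j => ?_))
  · exact measurableSet_lt measurable_const (hI j)
  · exact measurableSet_lt measurable_const ((hC j).sub (hI j))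

omit hN hinj in
lemma measure_eventually_bounded_eq_zero [Countable G] [Infinite G] [IsProbabilityMeasure μ]
    [SMulInvariantMeasure G X μ] (hfree : ∀ (x : X) (g : G), g • x = x → g = 1)
    {F : ℕ → X → ℕ} (hF : ∀ j, Measurable (F j))
    (hmono : ∀ x, Monotone fun j => F j x)
    (hFinj : ∀ j x y, p j x = p j y → F j x = F j y → x = y) :
    μ {x | (∀ g : G, ∃ j, p j x = p j (g • x)) ∧ ∃ n, ∀ j, F j x ≤ n} = 0 := by
  have hsub : {x | (∀ g : G, ∃ j, p j x = p j (g • x)) ∧ ∃ n, ∀ j, F j x ≤ n} ⊆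
      ⋃ m, {x | ∀ g : G, ∃ j, p j x = p j (g • x)} ∩ ⋃ i, ⋂ j, {x | i ≤ j → F j x = m} := by
    rintro x ⟨hx, n, hn⟩
    obtain ⟨m, i, hi⟩ := exists_eventually_eq_of_monotone_of_bounded (hmono x) hn
    exact Set.mem_iUnion.2 ⟨m, hx, Set.mem_iUnion.2 ⟨i, Set.mem_iInter.2 hi⟩⟩
  refine measure_mono_null hsub (measure_iUnion_null fun m => ?_)
  refine measure_eq_zero_of_partial_transversal (G := G) ?_ ?_
  · exact H.measurableSet_merging.inter (.iUnion fun i => .iInter fun j =>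
      (MeasurableSet.const _).imp (measurableSet_eq_fun (hF j) measurable_const))
  · rintro x ⟨hx, hxm⟩ g ⟨_, hgm⟩
    obtain ⟨j, hj⟩ := hx g
    obtain ⟨i, hi⟩ := Set.mem_iUnion.1 hxm
    obtain ⟨k, hk⟩ := Set.mem_iUnion.1 hgm
    rw [Set.mem_iInter] at hi hk
    set q := max j (max i k)
    have hle : ∀ n m, n ≤ m → p n x = p n (g • x) → p m x = p m (g • x) := fun n m hnm h => by
      induction m, hnm using Nat.le_induction with
      | base => exact h
      | succ m _ ih => exact H.refines m _ _ ih
    refine hfree x g (hFinj q x (g • x) (hle j q (le_max_left _ _) hj) ?_).symm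
    rw [hi q (by omega), hk q (by omega)]

include hl in
lemma measure_compl_clusterGoodSet [Countable G] [Infinite G] [IsProbabilityMeasure μ]
    [SMulInvariantMeasure G X μ] (hB : 0 < B) : μ (clusterGoodSet G p l)ᶜ = 0 := by
  have L := H.isLabelledHierarchy hN hinj
  have hI := H.measurable_clusterIndex hN hl hinj
  have hC := H.measurable_clusterCard hN hinj
  have hfree := smul_eq_of_label hinj
  have h1 := H.measure_eventually_bounded_eq_zero hfree hI
    (clusterIndex_mono p l) (fun j x y => L.clusterIndex_injective j)
  have h2 := H.measure_eventually_bounded_eq_zero hfree (fun j => (hC j).sub (hI j))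
    L.clusterCard_sub_clusterIndex_mono (fun j x y hxy heq => by
      refine L.clusterIndex_injective j hxy ?_
      have h3 := L.clusterIndex_lt_clusterCard j x
      have h4 := L.clusterIndex_lt_clusterCard j y
      have h5 : clusterCard p j x = clusterCard p j y := by simp only [clusterCard, hxy]
      simp only [Pi.sub_apply] at heq
      omega)
  have h3 : μ (⋃ g : G, ⋂ j, {x | p j x ≠ p j (g • x)}) = 0 := by
    refine measure_iUnion_null fun g => ?_
    obtain ⟨c, hc, hcj⟩ := H.separated g
    have hsum := (summable_clusterScale hB (a := 0) (c := 1) (by norm_num)).tendsto_atTop_zero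
    have hlim := hsum.const_mul c
    rw [mul_zero] at hlim
    rw [← measureReal_eq_zero_iff]
    refine le_antisymm (ge_of_tendsto' hlim fun j => ?_) measureReal_nonneg
    have hpos : (0 : ℝ) < clusterScale j := by exact_mod_cast clusterScale_pos j
    rw [Real.rpow_zero, Real.rpow_one, mul_one, ← mul_div_assoc, le_div_iff₀ hpos]
    refine le_trans ?_ (hcj j)
    exact mul_le_mul_of_nonneg_right (measureReal_mono
      (Set.iInter_subset (fun j => {x | p j x ≠ p j (g • x)}) j)) hpos.le
  refine measure_mono_null (fun x hx => ?_) (measure_union_null h3 (measure_union_null h1 h2))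
  by_cases hm : ∀ g : G, ∃ j, p j x = p j (g • x)
  · right
    by_cases hi : ∃ n, ∀ j, clusterIndex p l j x ≤ n
    · exact Or.inl ⟨hm, hi⟩
    · refine Or.inr ⟨hm, ?_⟩
      by_contra hcon
      push Not at hi hcon
      exact hx ⟨hm, hi, hcon⟩
  · left
    push Not at hm
    obtain ⟨g, hg⟩ := hm
    exact Set.mem_iUnion.2 ⟨g, Set.mem_iInter.2 hg⟩

end Measurability

end ClusterHierarchy

end GoodSet

lemma lintegral_le_of_levels {X : Type*} [MeasurableSpace X] {μ : Measure X}
    [IsProbabilityMeasure μ] {h : X → ENNReal} (M : ℕ → ENNReal) {E : ℕ → Set X}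
    (hE : ∀ j, MeasurableSet (E j)) (hEx : ∀ᵐ x ∂μ, ∃ j, x ∉ E j)
    (hM : ∀ᵐ x ∂μ, ∀ j, x ∉ E j → h x ≤ M j) :
    ∫⁻ x, h x ∂μ ≤ M 0 + ∑' j, M (j + 1) * μ (E j) := by
  classical
  calc ∫⁻ x, h x ∂μ ≤ ∫⁻ x, M 0 + ∑' j, (E j).indicator (fun _ => M (j + 1)) x ∂μ := by
        refine lintegral_mono_ae ?_
        filter_upwards [hEx, hM] with x hx hxM
        have h1 := Nat.find_spec hx
        rcases hk : Nat.find hx with _ | k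
        · rw [hk] at h1
          exact (hxM 0 h1).trans le_self_add
        · rw [hk] at h1
          have h2 : x ∈ E k := by
            by_contra hcon
            have := Nat.find_min' hx hcon
            omega
          refine (hxM _ h1).trans (le_trans ?_ le_add_self)
          refine le_trans ?_ (ENNReal.le_tsum k)
          rw [Set.indicator_of_mem h2]
    _ = M 0 + ∑' j, M (j + 1) * μ (E j) := by
        rw [lintegral_add_left measurable_const, lintegral_const, measure_univ, mul_one,
          lintegral_tsum fun j => (measurable_const.indicator (hE j)).aemeasurable]
        congr 1
        exact tsum_congr fun j => lintegral_indicator_const (hE j) _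

lemma le_rpow_of_le_one_of_le {s t θ : ℝ} (hs : 0 ≤ s) (hs1 : s ≤ 1) (hst : s ≤ t) (hθ : 0 ≤ θ)
    (hθ1 : θ ≤ 1) : s ≤ t ^ θ := by
  rcases hs.eq_or_lt with rfl | hpos
  · exact Real.rpow_nonneg hst _
  · calc s = s ^ (1 : ℝ) := (Real.rpow_one s).symm
      _ ≤ s ^ θ := Real.rpow_le_rpow_of_exponent_ge hpos hs1 hθ1
      _ ≤ t ^ θ := Real.rpow_le_rpow hs hst hθ

namespace IsLabelledHierarchy

section Offset

variable {G X : Type*} [Group G] [MulAction G X] {p : ℕ → X → X} {l : X → ℝ}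
  (L : IsLabelledHierarchy p l) {x : X} (hx : x ∈ clusterGoodSet G p l)
include L hx

lemma smul_mem_clusterGoodSet (h : G) : h • x ∈ clusterGoodSet G p l := by
  obtain ⟨hx1, hx2, hx3⟩ := hx
  obtain ⟨i, hi⟩ := hx1 h
  refine ⟨fun g => ?_, fun n => ?_, fun n => ?_⟩
  · obtain ⟨k, hk⟩ := hx1 (g * h)
    refine ⟨max i k, ?_⟩
    rw [← L.refines_le (le_max_left i k) hi, L.refines_le (le_max_right i k) hk, mul_smul]
  · obtain ⟨k, hk⟩ := hx2 (n + clusterIndex p l i x)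
    refine ⟨max i k, ?_⟩
    have h1 := L.clusterIndex_sub_eq hi (L.refines_le (le_max_left i k) hi)
    have h2 := clusterIndex_mono p l x (le_max_right i k)
    simp only at h2
    omega
  · obtain ⟨k, hk⟩ := hx3 (n + clusterIndex p l i (h • x))
    refine ⟨max i k, ?_⟩
    have hq := L.refines_le (le_max_left i k) hi
    have h1 := L.clusterIndex_sub_eq hi hq
    have h2 := L.clusterCard_sub_clusterIndex_mono x (le_max_right i k)
    have h3 : clusterCard p (max i k) (h • x) = clusterCard p (max i k) x := by
      simp only [clusterCard, hq]
    simp only at h2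
    omega

lemma clusterOffset_mul_smul (g h : G) : clusterOffset p l x ((g * h) • x) =
    clusterOffset p l (h • x) (g • h • x) + clusterOffset p l x (h • x) := by
  obtain ⟨i, hi⟩ := hx.1 h
  obtain ⟨k, hk⟩ := hx.1 (g * h)
  have h1 := L.refines_le (le_max_left i k) hi
  have h2 := L.refines_le (le_max_right i k) hk
  rw [L.clusterOffset_eq h1, L.clusterOffset_eq h2, ← mul_smul,
    L.clusterOffset_eq (h1.symm.trans h2)]
  ring

lemma clusterOffset_smul_injective (hfree : ∀ (x : X) (g : G), g • x = x → g = 1) :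
    Function.Injective fun g : G => clusterOffset p l x (g • x) := by
  intro g h hgh
  obtain ⟨i, hi⟩ := hx.1 g
  obtain ⟨k, hk⟩ := hx.1 h
  have h1 := L.refines_le (le_max_left i k) hi
  have h2 := L.refines_le (le_max_right i k) hk
  simp only [L.clusterOffset_eq h1, L.clusterOffset_eq h2] at hgh
  have h3 := L.clusterIndex_injective _ (h1.symm.trans h2) (by omega)
  have : (h⁻¹ * g) • x = x := by rw [mul_smul, h3, inv_smul_smul]
  exact (inv_mul_eq_one.1 (hfree x _ this)).symm

end Offset

end IsLabelledHierarchy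

/-- The points whose cluster of level `j` does not contain the point `n` steps further. -/
def clusterEscape {X : Type*} (p : ℕ → X → X) (l : X → ℝ) (n : ℤ) (j : ℕ) : Set X :=
  {x | (clusterIndex p l j x : ℤ) + n < 0 ∨ (clusterCard p j x : ℤ) ≤ clusterIndex p l j x + n}

lemma IsLabelledHierarchy.exists_notMem_clusterEscape {G X : Type*} [Group G] [MulAction G X]
    {p : ℕ → X → X} {l : X → ℝ} (L : IsLabelledHierarchy p l) {x : X}
    (hx : x ∈ clusterGoodSet G p l) (n : ℤ) : ∃ j, x ∉ clusterEscape p l n j := by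
  obtain ⟨i, hi⟩ := hx.2.1 n.natAbs
  obtain ⟨k, hk⟩ := hx.2.2 n.natAbs
  refine ⟨max i k, ?_⟩
  have h1 := clusterIndex_mono p l x (le_max_left i k)
  have h2 := L.clusterCard_sub_clusterIndex_mono x (le_max_right i k)
  simp only at h1 h2
  rw [clusterEscape, Set.mem_ofPred_eq]
  omega

namespace ClusterHierarchy

variable {G X : Type*} [Group G] [MeasurableSpace X] [MulAction G X]
  {N : G → ℕ} {r : ℕ} {A B : ℝ} {μ : Measure X} {p : ℕ → X → X} {l : X → ℝ}
  (H : ClusterHierarchy N r A B μ p) (hN : IsPolynomialLength N r A)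
  (hinj : ∀ (x : X) (g : G), l (g • x) = l x → g = 1)
include H hN hinj

lemma abs_clusterOffset_le {j : ℕ} {x y : X} (hj : p j x = p j y) :
    (|(clusterOffset p l x y : ℝ)|) ≤ A * (clusterScale j : ℝ) ^ r := by
  have L := H.isLabelledHierarchy hN hinj
  refine le_trans ?_ (H.clusterCard_le hN j x)
  have h1 := L.clusterIndex_lt_clusterCard j x
  have h2 := L.clusterIndex_lt_clusterCard j y
  have h3 : clusterCard p j y = clusterCard p j x := by simp only [clusterCard, hj]
  have : |clusterOffset p l x y| ≤ clusterCard p j x := by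
    rw [L.clusterOffset_eq hj, abs_le]
    omega
  exact_mod_cast this

lemma exists_clusterOffset_eq {n : ℤ} {j : ℕ} {x : X} (hx : x ∉ clusterEscape p l n j) :
    ∃ g : G, N g ≤ 8 * clusterScale j ∧ clusterOffset p l x (g • x) = n := by
  have L := H.isLabelledHierarchy hN hinj
  rw [clusterEscape, Set.mem_ofPred_eq] at hx
  push Not at hx
  obtain ⟨y, hy, hyn⟩ := L.exists_clusterIndex_eq j x
    (n := (clusterIndex p l j x + n).toNat) (by omega)
  obtain ⟨g, hg, rfl⟩ := H.exists_smul_of_eq hN hy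
  exact ⟨g, hg, by rw [L.clusterOffset_eq hy.symm]; omega⟩

lemma clusterOffset_smul_bijective {x : X} (hx : x ∈ clusterGoodSet G p l) :
    Function.Bijective fun g : G => clusterOffset p l x (g • x) := by
  have L := H.isLabelledHierarchy hN hinj
  refine ⟨L.clusterOffset_smul_injective hx (smul_eq_of_label hinj), fun n => ?_⟩
  obtain ⟨j, hj⟩ := L.exists_notMem_clusterEscape hx n
  obtain ⟨g, _, hg⟩ := H.exists_clusterOffset_eq hN hinj hj
  exact ⟨g, hg⟩

section Measurability

variable [StandardBorelSpace X] [MeasurableConstSMul G X] (hl : Measurable l)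
include hl

lemma measurableSet_clusterEscape (n : ℤ) (j : ℕ) : MeasurableSet (clusterEscape p l n j) := by
  have hI := H.measurable_clusterIndex hN hl hinj j
  have hC := H.measurable_clusterCard hN hinj j
  have hc : Measurable fun m : ℕ => (m : ℤ) := measurable_from_nat
  have h1 : Measurable fun x => (clusterIndex p l j x : ℤ) + n := (hc.comp hI).add_const n
  exact (measurableSet_lt h1 measurable_const).union (measurableSet_le (hc.comp hC) h1)

lemma measurableSet_clusterOffset_eq [Countable G] (g : G) (n : ℤ) :
    MeasurableSet (clusterGoodSet G p l ∩ {x | clusterOffset p l x (g • x) = n}) := by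
  have L := H.isLabelledHierarchy hN hinj
  have hI := H.measurable_clusterIndex hN hl hinj
  have hc : Measurable fun m : ℕ => (m : ℤ) := measurable_from_nat
  have : clusterGoodSet G p l ∩ {x | clusterOffset p l x (g • x) = n} =
      clusterGoodSet G p l ∩ ⋃ j, {x | p j x = p j (g • x)} ∩
        {x | (clusterIndex p l j (g • x) : ℤ) - clusterIndex p l j x = n} := by
    ext x
    simp only [Set.mem_inter_iff, Set.mem_iUnion, Set.mem_ofPred_eq]
    refine and_congr_right fun hx => ⟨fun h => ?_, fun ⟨j, hj, h⟩ => ?_⟩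
    · obtain ⟨j, hj⟩ := hx.1 g
      exact ⟨j, hj, by rw [← L.clusterOffset_eq hj, h]⟩
    · rw [L.clusterOffset_eq hj, h]
  rw [this]
  refine (H.measurableSet_clusterGoodSet hN hl hinj).inter (.iUnion fun j => ?_)
  refine (measurableSet_eq_fun (H.measurable j)
    ((H.measurable j).comp (measurable_const_smul g))).inter ?_
  exact measurableSet_eq_fun ((hc.comp ((hI j).comp (measurable_const_smul g))).sub
    (hc.comp (hI j))) measurable_const

lemma measureReal_clusterEscape_le [Countable G] [IsProbabilityMeasure μ]
    [SMulInvariantMeasure G X μ] (n : ℤ) (j : ℕ) :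
    μ.real (clusterEscape p l n j) ≤ |(n : ℝ)| * (A / (clusterScale j : ℝ) ^ r) := by
  have L := H.isLabelledHierarchy hN hinj
  have hI := H.measurable_clusterIndex hN hl hinj j
  have hC := H.measurable_clusterCard hN hinj j
  have hpos : (0 : ℝ) < (clusterScale j : ℝ) ^ r := by
    have : (0 : ℝ) < clusterScale j := by exact_mod_cast clusterScale_pos j
    positivity
  have piece : ∀ T : Set X, MeasurableSet T →
      (∀ x ∈ T, ∀ y ∈ T, p j x = p j y → clusterIndex p l j x = clusterIndex p l j y) →
      μ.real T ≤ A / (clusterScale j : ℝ) ^ r := by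
    intro T hT hTi
    obtain ⟨C, _, hpC, hCμ⟩ := H.range j
    have h1 : μ T ≤ μ C := measure_le_of_injOn (G := G) (smul_eq_of_label hinj) (H.measurable j) hT
      (fun x _ => (H.exists_smul j x).imp fun g hg => hg.2)
      (fun x hx y hy hxy => L.clusterIndex_injective j hxy (hTi x hx y hy hxy)) fun x _ => hpC x
    rw [le_div_iff₀ hpos]
    refine le_trans (mul_le_mul_of_nonneg_right ?_ hpos.le) hCμ
    exact ENNReal.toReal_mono (measure_ne_top _ _) h1
  have cover : ∀ T : ℕ → Set X, (clusterEscape p l n j ⊆ ⋃ i ∈ Finset.range n.natAbs, T i) →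
      (∀ i, μ.real (T i) ≤ A / (clusterScale j : ℝ) ^ r) →
      μ.real (clusterEscape p l n j) ≤ |(n : ℝ)| * (A / (clusterScale j : ℝ) ^ r) := by
    intro T hT hTμ
    calc μ.real (clusterEscape p l n j) ≤ μ.real (⋃ i ∈ Finset.range n.natAbs, T i) :=
          measureReal_mono hT (measure_ne_top _ _)
      _ ≤ ∑ i ∈ Finset.range n.natAbs, μ.real (T i) := measureReal_biUnion_finset_le _ _
      _ ≤ ∑ _i ∈ Finset.range n.natAbs, A / (clusterScale j : ℝ) ^ r :=
          Finset.sum_le_sum fun i _ => hTμ i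
      _ = |(n : ℝ)| * (A / (clusterScale j : ℝ) ^ r) := by
          rw [Finset.sum_const, Finset.card_range, nsmul_eq_mul, Nat.cast_natAbs, Int.cast_abs]
  rcases le_total 0 n with hn | hn
  · refine cover (fun i => {x | clusterIndex p l j x + i + 1 = clusterCard p j x})
      (fun x hx => ?_) (fun i => piece _ ?_ fun x hx y hy hxy => ?_)
    · have := L.clusterIndex_lt_clusterCard j x
      rw [clusterEscape, Set.mem_ofPred_eq] at hx
      refine Set.mem_biUnion (x := clusterCard p j x - clusterIndex p l j x - 1) ?_ ?_
      · simp only [Finset.coe_range, Set.mem_Iio]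
        omega
      · rw [Set.mem_ofPred_eq]
        omega
    · exact measurableSet_eq_fun ((hI.add_const i).add_const 1) hC
    · rw [Set.mem_ofPred_eq] at hx hy
      have : clusterCard p j x = clusterCard p j y := by simp only [clusterCard, hxy]
      omega
  · refine cover (fun i => {x | clusterIndex p l j x = i})
      (fun x hx => ?_) (fun i => piece _ ?_ fun x hx y hy hxy => hx.trans hy.symm)
    · have := L.clusterIndex_lt_clusterCard j x
      rw [clusterEscape, Set.mem_ofPred_eq] at hx
      refine Set.mem_biUnion (x := clusterIndex p l j x) ?_ ?_
      · simp only [Finset.coe_range, Set.mem_Iio]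
        omega
      · rfl
    · exact measurableSet_eq_fun hI measurable_const

end Measurability

end ClusterHierarchy

namespace ClusterHierarchy

variable {G X : Type*} [Group G] [Countable G] [Infinite G] [MeasurableSpace X]
  [StandardBorelSpace X] [MulAction G X] [MeasurableConstSMul G X]
  {N : G → ℕ} {r : ℕ} {A B : ℝ} {μ : Measure X} [IsProbabilityMeasure μ]
  [SMulInvariantMeasure G X μ] {p : ℕ → X → X} {l : X → ℝ}
  (H : ClusterHierarchy N r A B μ p) (hN : IsPolynomialLength N r A) (hl : Measurable l)
  (hinj : ∀ (x : X) (g : G), l (g • x) = l x → g = 1) (hB : 0 < B)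
include H hN hl hinj hB

lemma lintegral_clusterOffset_lt_top (g : G) {s : ℝ} (hs : 0 < s) (hsr : s * r < 1) :
    ∫⁻ x, ENNReal.ofReal (|(clusterOffset p l x (g • x) : ℝ)| ^ s) ∂μ < ⊤ := by
  have hA : 0 < A := one_pos.trans_le hN.one_le
  have hsc : ∀ j : ℕ, (0 : ℝ) < clusterScale j := fun j => by exact_mod_cast clusterScale_pos j
  obtain ⟨c, hc, hcj⟩ := H.separated g
  have hgood : ∀ᵐ x ∂μ, x ∈ clusterGoodSet G p l :=
    measure_eq_zero_iff_ae_notMem.1 (H.measure_compl_clusterGoodSet hN hl hinj hB) |>.mono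
      fun x hx => not_not.1 hx
  refine lt_of_le_of_lt (lintegral_le_of_levels
    (fun j => ENNReal.ofReal ((A * (clusterScale j : ℝ) ^ r) ^ s))
    (E := fun j => {x | p j x = p j (g • x)}ᶜ) (fun j => ?_) ?_ ?_) ?_
  · exact (measurableSet_eq_fun (H.measurable j)
      ((H.measurable j).comp (measurable_const_smul g))).compl
  · filter_upwards [hgood] with x hx
    obtain ⟨j, hj⟩ := hx.1 g
    exact ⟨j, fun h => h hj⟩
  · filter_upwards with x j hj
    exact ENNReal.ofReal_le_ofReal (Real.rpow_le_rpow (abs_nonneg _)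
      (H.abs_clusterOffset_le hN hinj (not_not.1 hj)) hs.le)
  · refine ENNReal.add_lt_top.2 ⟨ENNReal.ofReal_lt_top, ?_⟩
    have hsum := (summable_clusterScale hB (a := r * s) (c := 1) (by linarith)).mul_left (A ^ s * c)
    refine lt_of_le_of_lt (ENNReal.tsum_le_tsum fun j => ?_) hsum.tsum_ofReal_lt_top
    rw [← ENNReal.ofReal_toReal (measure_ne_top μ {x | p j x = p j (g • x)}ᶜ),
      ← ENNReal.ofReal_mul (by positivity)]
    refine ENNReal.ofReal_le_ofReal ?_
    have h1 : μ.real {x | p j x = p j (g • x)}ᶜ ≤ c * B ^ j / clusterScale j :=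
      (le_div_iff₀ (hsc j)).2 (hcj j)
    have h2 := hsc (j + 1)
    refine (mul_le_mul_of_nonneg_left h1 (by positivity)).trans_eq ?_
    rw [Real.mul_rpow hA.le (by positivity), ← Real.rpow_natCast, ← Real.rpow_mul h2.le,
      Real.rpow_one]
    ring

lemma exists_lintegral_length_le {s θ : ℝ} (hs : 0 < s) (hsθ : s < r * θ) (hθ : 0 ≤ θ)
    (hθ1 : θ ≤ 1) : ∃ K : ℝ, 0 ≤ K ∧ ∀ n : ℤ,
      ∫⁻ x, ENNReal.ofReal
        ((N (Function.invFun (fun g : G => clusterOffset p l x (g • x)) n) : ℝ) ^ s) ∂μ ≤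
        ENNReal.ofReal (K * (1 + |(n : ℝ)| ^ θ)) := by
  have L := H.isLabelledHierarchy hN hinj
  have hA : 0 < A := one_pos.trans_le hN.one_le
  have hsc : ∀ j : ℕ, (0 : ℝ) < clusterScale j := fun j => by exact_mod_cast clusterScale_pos j
  have hgood : ∀ᵐ x ∂μ, x ∈ clusterGoodSet G p l :=
    measure_eq_zero_iff_ae_notMem.1 (H.measure_compl_clusterGoodSet hN hl hinj hB) |>.mono
      fun x hx => not_not.1 hx
  have hsum := (summable_clusterScale one_pos hsθ).mul_left ((8 : ℝ) ^ s * A ^ θ)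
  set F : ℕ → ℝ := fun j => (8 : ℝ) ^ s * A ^ θ *
    (1 ^ j * (clusterScale (j + 1) : ℝ) ^ s / (clusterScale j : ℝ) ^ (r * θ))
  have hF : ∀ j, 0 ≤ F j := fun j => by positivity
  have hF0 : 0 ≤ ∑' j, F j := tsum_nonneg hF
  refine ⟨8 ^ s + ∑' j, F j, by positivity, fun n => ?_⟩
  refine (lintegral_le_of_levels (fun j => ENNReal.ofReal ((8 * (clusterScale j : ℝ)) ^ s))
    (E := clusterEscape p l n) (H.measurableSet_clusterEscape hN hinj hl n) ?_ ?_).trans ?_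
  · filter_upwards [hgood] with x hx using L.exists_notMem_clusterEscape hx n
  · filter_upwards [hgood] with x hx j hj
    obtain ⟨g, hg, hgn⟩ := H.exists_clusterOffset_eq hN hinj hj
    have hgx : Function.invFun (fun g : G => clusterOffset p l x (g • x)) n = g := by
      rw [← hgn]
      exact Function.leftInverse_invFun
        (L.clusterOffset_smul_injective hx (smul_eq_of_label hinj)) g
    rw [hgx]
    exact ENNReal.ofReal_le_ofReal (Real.rpow_le_rpow (by positivity) (by exact_mod_cast hg) hs.le)
  · have hterm : ∀ j, ENNReal.ofReal ((8 * (clusterScale (j + 1) : ℝ)) ^ s) *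
        μ (clusterEscape p l n j) ≤ ENNReal.ofReal (|(n : ℝ)| ^ θ * F j) := by
      intro j
      have h1 := H.measureReal_clusterEscape_le hN hinj hl n j
      have h2 := le_rpow_of_le_one_of_le measureReal_nonneg measureReal_le_one h1 hθ hθ1
      have h3 := hsc j
      have h4 := hsc (j + 1)
      rw [← ENNReal.ofReal_toReal (measure_ne_top μ (clusterEscape p l n j)),
        ← ENNReal.ofReal_mul (by positivity)]
      refine ENNReal.ofReal_le_ofReal ((mul_le_mul_of_nonneg_left h2 (by positivity)).trans_eq ?_)
      rw [Real.mul_rpow (by positivity) (by positivity), Real.mul_rpow (by positivity)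
        (by positivity), Real.div_rpow hA.le (by positivity), ← Real.rpow_natCast,
        ← Real.rpow_mul h3.le]
      simp only [F]
      ring
    refine (add_le_add_right (ENNReal.tsum_le_tsum hterm) _).trans ?_
    rw [← ENNReal.ofReal_tsum_of_nonneg (fun j => mul_nonneg (by positivity) (hF j))
      (hsum.mul_left _), tsum_mul_left, clusterScale_zero, Nat.cast_one, mul_one,
      ← ENNReal.ofReal_add (by positivity) (by positivity)]
    refine ENNReal.ofReal_le_ofReal ?_
    have h8 : (0 : ℝ) < 8 ^ s := by positivity
    have hn : (0 : ℝ) ≤ |(n : ℝ)| ^ θ := by positivity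
    nlinarith [mul_nonneg h8.le hn]

end ClusterHierarchy

section Restrict

variable {G X : Type*} [Group G] [MeasurableSpace X] [MulAction G X] (Y : SubMulAction G X)
  {μ : Measure X}

lemma SubMulAction.measurableConstSMul [MeasurableConstSMul G X] : MeasurableConstSMul G Y where
  measurable_const_smul g :=
    ((measurable_const_smul g).comp measurable_subtype_coe).subtype_mk

variable {Y} (hY : MeasurableSet (Y : Set X))
include hY

lemma SubMulAction.smulInvariantMeasure [MeasurableConstSMul G X] [SMulInvariantMeasure G X μ] :
    SMulInvariantMeasure G Y (μ.comap Subtype.val) where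
  measure_preimage_smul g s hs := by
    have he : MeasurableEmbedding (Subtype.val : Y → X) := MeasurableEmbedding.subtype_coe hY
    rw [he.comap_apply, he.comap_apply, ← measure_preimage_smul μ g (Subtype.val '' s)]
    congr 1
    ext x
    constructor
    · rintro ⟨y, hy, rfl⟩
      exact ⟨g • y, hy, rfl⟩
    · rintro ⟨z, hz, hzx⟩
      refine ⟨g⁻¹ • z, ?_, ?_⟩
      · simpa using hz
      · change g⁻¹ • (z : X) = x
        rw [hzx]
        exact inv_smul_smul g x

lemma SubMulAction.isProbabilityMeasure_comap [IsProbabilityMeasure μ]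
    (hμ : μ (Y : Set X)ᶜ = 0) : IsProbabilityMeasure (μ.comap (Subtype.val : Y → X)) where
  measure_univ := by
    have he : MeasurableEmbedding (Subtype.val : Y → X) := MeasurableEmbedding.subtype_coe hY
    rw [he.comap_apply, Set.image_univ, Subtype.range_val]
    exact (prob_compl_eq_zero_iff hY).1 hμ

lemma SubMulAction.lintegral_comap_le (h : X → ENNReal) :
    ∫⁻ y : Y, h y ∂μ.comap Subtype.val ≤ ∫⁻ x, h x ∂μ := by
  have he : MeasurableEmbedding (Subtype.val : Y → X) := MeasurableEmbedding.subtype_coe hY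
  rw [← he.lintegral_map, he.map_comap]
  exact setLIntegral_le_lintegral _ _

end Restrict

/-- An equivariant way of numbering the orbits of an action by the integers, such that the cocycles
which compare the numbering with the length function `N` have small moments. -/
structure IntegrableOrdering {G X : Type*} [Group G] [MeasurableSpace X] [MulAction G X]
    (N : G → ℕ) (r : ℕ) (μ : Measure X) (b : X → G → ℤ) : Prop where
  free : ∀ (x : X) (g : G), g • x = x → g = 1
  bijective : ∀ x, Function.Bijective (b x)
  mul : ∀ x g h, b x (g * h) = b (h • x) g + b x h
  measurable : ∀ g, Measurable fun x => b x g
  lintegral_lt_top : ∀ (g : G) (s : ℝ), 0 < s → s * r < 1 →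
    ∫⁻ x, ENNReal.ofReal (|(b x g : ℝ)| ^ s) ∂μ < ⊤
  exists_lintegral_le : ∀ s θ : ℝ, 0 < s → s < r * θ → 0 ≤ θ → θ ≤ 1 → ∃ K : ℝ, 0 ≤ K ∧ ∀ n : ℤ,
    ∫⁻ x, ENNReal.ofReal ((N (Function.invFun (b x) n) : ℝ) ^ s) ∂μ ≤
      ENNReal.ofReal (K * (1 + |(n : ℝ)| ^ θ))

lemma ClusterHierarchy.integrableOrdering {G X : Type*} [Group G] [Countable G] [Infinite G]
    [MeasurableSpace X] [StandardBorelSpace X] [MulAction G X] [MeasurableConstSMul G X]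
    {N : G → ℕ} {r : ℕ} {A B : ℝ} {μ : Measure X} [IsProbabilityMeasure μ]
    [SMulInvariantMeasure G X μ] {p : ℕ → X → X} {l : X → ℝ}
    (H : ClusterHierarchy N r A B μ p) (hN : IsPolynomialLength N r A) (hl : Measurable l)
    (hinj : ∀ (x : X) (g : G), l (g • x) = l x → g = 1) (hB : 0 < B)
    {Y : SubMulAction G X} (hY : (Y : Set X) = clusterGoodSet G p l) :
    IntegrableOrdering N r (μ.comap (Subtype.val : Y → X))
      fun x g => clusterOffset p l (x : X) (g • (x : X)) := by
  have L := H.isLabelledHierarchy hN hinj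
  have hgood := H.measurableSet_clusterGoodSet hN hl hinj
  have hYm : MeasurableSet (Y : Set X) := by rwa [hY]
  have hmem : ∀ x : Y, (x : X) ∈ clusterGoodSet G p l := fun x => hY ▸ x.2
  refine ⟨fun x g hg => smul_eq_of_label hinj (x : X) g (congrArg Subtype.val hg), fun x =>
    H.clusterOffset_smul_bijective hN hinj (hmem x), fun x g h =>
    L.clusterOffset_mul_smul (hmem x) g h, fun g => measurable_to_countable' fun n => ?_,
    fun g s hs hsr => ?_, fun s θ hs hsθ hθ hθ1 => ?_⟩
  · have := measurable_subtype_coe (p := (· ∈ Y))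
      (H.measurableSet_clusterOffset_eq hN hinj hl g n)
    convert this using 1
    ext x
    simp [hmem x]
  · exact (SubMulAction.lintegral_comap_le hYm
      fun x => ENNReal.ofReal (|(clusterOffset p l x (g • x) : ℝ)| ^ s)).trans_lt
      (H.lintegral_clusterOffset_lt_top hN hl hinj hB g hs hsr)
  · obtain ⟨K, hK, hKn⟩ := H.exists_lintegral_length_le hN hl hinj hB hs hsθ hθ hθ1
    exact ⟨K, hK, fun n => (SubMulAction.lintegral_comap_le hYm fun x => ENNReal.ofReal
      ((N (Function.invFun (fun g : G => clusterOffset p l x (g • x)) n) : ℝ) ^ s)).trans (hKn n)⟩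

theorem exists_integrableOrdering_of_label {G : Type*} {X : Type} [Group G] [Countable G]
    [Infinite G] [MeasurableSpace X] [StandardBorelSpace X] [MulAction G X]
    [MeasurableConstSMul G X] {N : G → ℕ} {r : ℕ} {A : ℝ} {μ : Measure X} [IsProbabilityMeasure μ]
    [SMulInvariantMeasure G X μ] (hN : IsPolynomialLength N r A) {l : X → ℝ} (hl : Measurable l)
    (hinj : ∀ (x : X) (g : G), l (g • x) = l x → g = 1) (S : Finset G) (hS : ∀ s ∈ S, N s ≤ 1)
    (hgen : Subgroup.closure (S : Set G) = ⊤) :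
    ∃ (Y : Type) (_ : MeasurableSpace Y) (_ : StandardBorelSpace Y) (_ : MulAction G Y)
      (_ : MeasurableConstSMul G Y) (ν : Measure Y) (_ : IsProbabilityMeasure ν)
      (_ : SMulInvariantMeasure G Y ν) (b : Y → G → ℤ), IntegrableOrdering N r ν b := by
  obtain ⟨p, H⟩ := exists_clusterHierarchy (μ := μ) hN hl hinj S hS hgen
  have hB : 0 < 9 * A ^ 2 := by have := hN.one_le; positivity
  have hgood := H.measurableSet_clusterGoodSet hN hl hinj
  let Y : SubMulAction G X := ⟨clusterGoodSet G p l, fun g {x} hx =>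
    (H.isLabelledHierarchy hN hinj).smul_mem_clusterGoodSet hx g⟩
  exact ⟨Y, inferInstance, hgood.standardBorel, inferInstance, Y.measurableConstSMul,
    μ.comap Subtype.val, SubMulAction.isProbabilityMeasure_comap hgood
      (H.measure_compl_clusterGoodSet hN hl hinj hB), SubMulAction.smulInvariantMeasure hgood, _,
    H.integrableOrdering hN hl hinj hB (Y := Y) rfl⟩

/-- The Bernoulli shift of a group over its enumeration. -/
abbrev bernoulliShift {G : Type*} [Group G] (e : G ≃ ℕ) : MulAction G (ℕ → ℝ) where
  smul g x n := x (e (g⁻¹ * e.symm n))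
  one_smul x := funext fun n => by
    change x (e (1⁻¹ * e.symm n)) = x n
    simp
  mul_smul g h x := funext fun n => by
    change x (e ((g * h)⁻¹ * e.symm n)) = x (e (h⁻¹ * e.symm (e (g⁻¹ * e.symm n))))
    simp [mul_assoc]

lemma measurableSet_injective_seq : MeasurableSet {x : ℕ → ℝ | Function.Injective x} := by
  have : {x : ℕ → ℝ | Function.Injective x} = ⋂ m, ⋂ n, {x | x m = x n → m = n} := by
    ext x
    simp [Function.Injective]
  rw [this]
  exact .iInter fun m => .iInter fun n =>
    (measurableSet_eq_fun (measurable_pi_apply m) (measurable_pi_apply n)).imp (.const _)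

lemma infinitePi_injective_seq (P : Measure ℝ) [IsProbabilityMeasure P] [NullSingletonClass P] :
    Measure.infinitePi (fun _ : ℕ => P) {x | Function.Injective x}ᶜ = 0 := by
  have hsub : {x : ℕ → ℝ | Function.Injective x}ᶜ ⊆
      ⋃ m, ⋃ n, ⋃ _ : m ≠ n, (fun x : ℕ → ℝ => (x m, x n)) ⁻¹' Set.diagonal ℝ := by
    intro x hx
    simp only [Set.mem_compl_iff, Set.mem_ofPred_eq, Function.Injective] at hx
    push Not at hx
    obtain ⟨m, n, h, hmn⟩ := hx
    simp only [Set.mem_iUnion]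
    exact ⟨m, n, hmn, h⟩
  refine measure_mono_null hsub (measure_iUnion_null fun m => measure_iUnion_null fun n =>
    measure_iUnion_null fun hmn => ?_)
  rw [← Measure.map_apply (by fun_prop) measurableSet_diagonal,
    Measure.infinitePi_map_eval_prod hmn,
    Measure.measure_prod_null measurableSet_diagonal]
  refine .of_forall fun x => ?_
  have : Prod.mk x ⁻¹' Set.diagonal ℝ = {x} := by
    ext y
    simp [eq_comm]
  change P (Prod.mk x ⁻¹' Set.diagonal ℝ) = 0
  rw [this, measure_singleton]

theorem exists_integrableOrdering {G : Type*} [Group G] [Countable G] [Infinite G] {N : G → ℕ}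
    {r : ℕ} {A : ℝ} (hN : IsPolynomialLength N r A) (S : Finset G) (hS : ∀ s ∈ S, N s ≤ 1)
    (hgen : Subgroup.closure (S : Set G) = ⊤) :
    ∃ (Y : Type) (_ : MeasurableSpace Y) (_ : StandardBorelSpace Y) (_ : MulAction G Y)
      (_ : MeasurableConstSMul G Y) (ν : Measure Y) (_ : IsProbabilityMeasure ν)
      (_ : SMulInvariantMeasure G Y ν) (b : Y → G → ℤ), IntegrableOrdering N r ν b := by
  obtain ⟨e⟩ : Nonempty (G ≃ ℕ) := nonempty_equiv_of_countable
  let _ := bernoulliShift e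
  have hsmul : ∀ (g : G) (x : ℕ → ℝ) n, (g • x) n = x (e (g⁻¹ * e.symm n)) := fun _ _ _ => rfl
  have : MeasurableConstSMul G (ℕ → ℝ) :=
    ⟨fun g => measurable_pi_lambda _ fun n => measurable_pi_apply _⟩
  let P : Measure ℝ := volume.restrict (Set.Ioc 0 1)
  have : IsProbabilityMeasure P := ⟨by simp [P]⟩
  let μ : Measure (ℕ → ℝ) := Measure.infinitePi fun _ => P
  have : SMulInvariantMeasure G (ℕ → ℝ) μ := by
    refine ⟨fun g s hs => ?_⟩
    have hf : Function.Injective fun n => e (g⁻¹ * e.symm n) :=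
      e.injective.comp ((mul_right_injective g⁻¹).comp e.symm.injective)
    have h1 : μ.map (fun x => g • x) = μ :=
      Measure.map_infinitePi_infinitePi_of_inj (P := fun _ => P) hf
    rw [← Measure.map_apply (measurable_const_smul g) hs, h1]
  have hYm := measurableSet_injective_seq
  let Y : SubMulAction G (ℕ → ℝ) := ⟨{x | Function.Injective x}, fun g x hx m n hmn => by
    have := e.injective (hx hmn)
    simpa using this⟩
  have := Y.measurableConstSMul
  have : SMulInvariantMeasure G Y (μ.comap Subtype.val) := SubMulAction.smulInvariantMeasure hYm
  have : IsProbabilityMeasure (μ.comap (Subtype.val : Y → ℕ → ℝ)) :=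
    SubMulAction.isProbabilityMeasure_comap hYm (infinitePi_injective_seq P)
  have : StandardBorelSpace Y := hYm.standardBorel
  refine exists_integrableOrdering_of_label (μ := μ.comap (Subtype.val : Y → ℕ → ℝ)) hN
    (l := fun x => (x : ℕ → ℝ) (e 1)) ((measurable_pi_apply _).comp measurable_subtype_coe)
    (fun x g hg => ?_) S hS hgen
  have : e (g⁻¹ * e.symm (e 1)) = e 1 := x.2 hg
  simpa using this

section WordLength

open scoped Pointwise

variable {G : Type*} [Group G] {S : Set G}

lemma wordLength_le {g : G} {n : ℕ} (h : g ∈ S ^ n) : wordLength S g ≤ n := Nat.sInf_le h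

lemma mem_pow_wordLength (hsymm : S⁻¹ = S) (hgen : Subgroup.closure S = ⊤) (g : G) :
    g ∈ S ^ wordLength S g := by
  refine Nat.sInf_mem (s := {n : ℕ | g ∈ S ^ n}) ?_
  have hg : g ∈ Subgroup.closure S := by rw [hgen]; trivial
  induction hg using Subgroup.closure_induction with
  | mem x hx => exact ⟨1, by simpa using hx⟩
  | one => exact ⟨0, by simp⟩
  | mul x y _ _ hx hy =>
    obtain ⟨m, hm⟩ := hx
    obtain ⟨n, hn⟩ := hy
    refine ⟨m + n, ?_⟩
    rw [Set.mem_ofPred_eq, pow_add]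
    exact Set.mul_mem_mul hm hn
  | inv x _ hx =>
    obtain ⟨n, hn⟩ := hx
    refine ⟨n, ?_⟩
    rw [Set.mem_ofPred_eq, ← hsymm, inv_pow]
    exact Set.inv_mem_inv.2 hn

lemma HasPolynomialGrowthDeg.exists_isPolynomialLength {r : ℕ} (h : HasPolynomialGrowthDeg S r)
    (hsymm : S⁻¹ = S) (hgen : Subgroup.closure S = ⊤) :
    ∃ A, IsPolynomialLength (wordLength S) r A := by
  obtain ⟨C, hC, hn⟩ := h
  have hcard : ∀ n, Nat.card {γ : G // wordLength S γ ≤ n} = {g | wordLength S g ≤ n}.ncard :=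
    fun n => Nat.card_coe_set_eq {g | wordLength S g ≤ n}
  simp only [hcard] at hn
  have hone : wordLength S (1 : G) = 0 := Nat.le_zero.1 (wordLength_le (by simp))
  have hinv : ∀ g, wordLength S g⁻¹ ≤ wordLength S g := fun g => by
    refine wordLength_le ?_
    have := mem_pow_wordLength hsymm hgen g
    nth_rewrite 1 [← hsymm]
    rw [inv_pow]
    exact Set.inv_mem_inv.2 this
  have hfin : ∀ n, {g | wordLength S g ≤ n}.Finite := by
    intro n
    refine Set.Finite.subset (s := {g | wordLength S g ≤ n + 1}) ?_ fun g hg =>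
      le_trans (show wordLength S g ≤ n from hg) n.le_succ
    by_contra hinf
    have h1 := (hn (n + 1) (by omega)).1
    rw [Set.Infinite.ncard hinf, Nat.cast_zero, mul_zero] at h1
    have : (0 : ℝ) < ((n + 1 : ℕ) : ℝ) ^ r := by positivity
    linarith
  have h8 : (1 : ℝ) ≤ 8 ^ r := one_le_pow₀ (by norm_num)
  refine ⟨C * 8 ^ r, hone, fun g h => wordLength_le ?_,
    fun g => (hinv g).antisymm (by simpa using hinv g⁻¹), hfin,
    one_le_mul_of_one_le_of_one_le hC h8, fun R hR => ?_, fun R hR => ?_⟩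
  · rw [pow_add]
    exact Set.mul_mem_mul (mem_pow_wordLength hsymm hgen g) (mem_pow_wordLength hsymm hgen h)
  · rcases hR.eq_or_lt with rfl | hR2
    · have h1 : 1 ≤ {g | wordLength S g ≤ 1 / 2}.ncard :=
        (Set.ncard_pos (hfin _)).2 ⟨1, hone.le.trans (Nat.zero_le _)⟩
      rw [Nat.cast_one, one_pow]
      exact one_le_mul_of_one_le_of_one_le (one_le_mul_of_one_le_of_one_le hC h8)
        (by exact_mod_cast h1)
    · have h1 := (hn (R / 2) (by omega)).1
      have h2 : (R : ℝ) ≤ 8 * ((R / 2 : ℕ) : ℝ) := by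
        have : R ≤ 8 * (R / 2) := by omega
        exact_mod_cast this
      calc (R : ℝ) ^ r ≤ (8 * ((R / 2 : ℕ) : ℝ)) ^ r := pow_le_pow_left₀ (by positivity) h2 r
        _ = 8 ^ r * ((R / 2 : ℕ) : ℝ) ^ r := mul_pow _ _ _
        _ ≤ 8 ^ r * (C * {g | wordLength S g ≤ R / 2}.ncard) := by gcongr
        _ = C * 8 ^ r * {g | wordLength S g ≤ R / 2}.ncard := by ring
  · have h1 := (hn (8 * R) (by omega)).2
    push_cast at h1
    rw [mul_pow, ← mul_assoc] at h1
    exact h1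

lemma IsPolynomialLength.countable {N : G → ℕ} {r : ℕ} {A : ℝ} (hN : IsPolynomialLength N r A) :
    Countable G := by
  rw [← Set.countable_univ_iff]
  exact (Set.countable_iUnion fun n => (hN.finite n).countable).mono fun g _ =>
    Set.mem_iUnion.2 ⟨N g, le_refl (N g)⟩

lemma HasPolynomialGrowthDeg.exists_integrableOrdering [Infinite G] {r : ℕ}
    (h : HasPolynomialGrowthDeg S r) (hfin : S.Finite) (hsymm : S⁻¹ = S)
    (hgen : Subgroup.closure S = ⊤) :
    Countable G ∧ ∃ (Y : Type) (_ : MeasurableSpace Y) (_ : StandardBorelSpace Y)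
      (_ : MulAction G Y) (_ : MeasurableConstSMul G Y) (ν : Measure Y)
      (_ : IsProbabilityMeasure ν) (_ : SMulInvariantMeasure G Y ν) (b : Y → G → ℤ),
      IntegrableOrdering (wordLength S) r ν b := by
  obtain ⟨A, hA⟩ := h.exists_isPolynomialLength hsymm hgen
  have := hA.countable
  exact ⟨this, _root_.exists_integrableOrdering hA hfin.toFinset
    (fun s hs => wordLength_le (by simpa using hs)) (by simpa using hgen)⟩

end WordLength

namespace IntegrableOrdering

section Basic

variable {G X : Type*} [Group G] [MeasurableSpace X] [MulAction G X] {N : G → ℕ} {r : ℕ}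
  {μ : Measure X} {b : X → G → ℤ} (H : IntegrableOrdering N r μ b)
include H

lemma map_one (x : X) : b x 1 = 0 := by
  have := H.mul x 1 1
  rw [one_smul, mul_one] at this
  omega

lemma apply_invFun (x : X) (n : ℤ) : b x (Function.invFun (b x) n) = n :=
  Function.rightInverse_invFun (H.bijective x).2 n

lemma invFun_eq_iff {x : X} {n : ℤ} {g : G} : Function.invFun (b x) n = g ↔ b x g = n :=
  ⟨fun h => h ▸ H.apply_invFun x n, fun h => h ▸ Function.leftInverse_invFun (H.bijective x).1 g⟩

lemma invFun_zero (x : X) : Function.invFun (b x) 0 = 1 := H.invFun_eq_iff.2 (H.map_one x)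

lemma invFun_add (x : X) (m n : ℤ) : Function.invFun (b x) (m + n) =
    Function.invFun (b (Function.invFun (b x) n • x)) m * Function.invFun (b x) n := by
  rw [H.invFun_eq_iff, H.mul, H.apply_invFun, H.apply_invFun]

variable [MeasurableConstSMul G X] [Countable G]

lemma measurable_invFun_smul {Z : Type*} [MeasurableSpace Z] {φ : Z → X} {ψ : Z → ℤ}
    (hφ : Measurable φ) (hψ : Measurable ψ) :
    Measurable fun z => Function.invFun (b (φ z)) (ψ z) • φ z := by
  intro T hT
  have : (fun z => Function.invFun (b (φ z)) (ψ z) • φ z) ⁻¹' T =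
      ⋃ g : G, {z | b (φ z) g = ψ z} ∩ (fun z => g • φ z) ⁻¹' T := by
    ext z
    simp only [Set.mem_preimage, Set.mem_iUnion, Set.mem_inter_iff, Set.mem_ofPred_eq]
    constructor
    · exact fun h => ⟨_, H.apply_invFun _ _, h⟩
    · rintro ⟨g, hg, h⟩
      rwa [H.invFun_eq_iff.2 hg]
  rw [this]
  exact .iUnion fun g => (measurableSet_eq_fun ((H.measurable g).comp hφ) hψ).inter
    (((measurable_const_smul g).comp hφ) hT)

lemma map_invFun_smul [StandardBorelSpace X] [SMulInvariantMeasure G X μ] (n : ℤ) :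
    μ.map (fun x => Function.invFun (b x) n • x) = μ := by
  have hmeas : ∀ m : ℤ, Measurable fun x => Function.invFun (b x) m • x := fun m =>
    H.measurable_invFun_smul measurable_id measurable_const
  have hinv : ∀ (m : ℤ) x, Function.invFun (b (Function.invFun (b x) m • x)) (-m) •
      Function.invFun (b x) m • x = x := fun m x => by
    rw [← mul_smul, ← H.invFun_add, neg_add_cancel, H.invFun_zero, one_smul]
  have hinj : ∀ m : ℤ, Function.Injective fun x => Function.invFun (b x) m • x := fun m =>
    Function.LeftInverse.injective (g := fun x => Function.invFun (b x) (-m) • x) (hinv m)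
  ext T hT
  rw [Measure.map_apply (hmeas n) hT]
  refine le_antisymm ?_ ?_
  · exact measure_le_of_injOn (G := G) H.free (hmeas n) (hmeas n hT) (fun x _ => ⟨_, rfl⟩)
      (hinj n).injOn fun x hx => hx
  · refine measure_le_of_injOn (G := G) H.free (hmeas (-n)) hT (fun x _ => ⟨_, rfl⟩)
      (hinj (-n)).injOn fun x hx => ?_
    have := hinv (-n) x
    rw [neg_neg] at this
    rwa [Set.mem_preimage, this]

end Basic

end IntegrableOrdering

/-- The element of the second group which moves a point as far as the given element of the first
group does. -/
noncomputable def crossCocycle {G H X Y : Type*} [One H] (b : X → G → ℤ) (b' : Y → H → ℤ) (g : G)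
    (z : X × Y) : H :=
  Function.invFun (b' z.2) (b z.1 g)

/-- The action on the product which moves both coordinates equally far. -/
noncomputable def crossAct {G H X Y : Type*} [One H] [SMul G X] [SMul H Y] (b : X → G → ℤ)
    (b' : Y → H → ℤ) (g : G) (z : X × Y) : X × Y :=
  (g • z.1, crossCocycle b b' g z • z.2)

section Cross

variable {G H X Y : Type*} [Group G] [Group H] [MeasurableSpace X] [MeasurableSpace Y]
  [MulAction G X] [MulAction H Y] {N : G → ℕ} {N' : H → ℕ} {r r' : ℕ}
  {μ : Measure X} {ν : Measure Y} {b : X → G → ℤ} {b' : Y → H → ℤ}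
  (hb : IntegrableOrdering N r μ b) (hb' : IntegrableOrdering N' r' ν b')
include hb hb'

lemma crossAct_one (z : X × Y) : crossAct b b' 1 z = z := by
  simp [crossAct, crossCocycle, hb.map_one, hb'.invFun_zero]

lemma crossAct_mul (g g' : G) (z : X × Y) :
    crossAct b b' (g * g') z = crossAct b b' g (crossAct b b' g' z) := by
  simp only [crossAct, crossCocycle, hb.mul, hb'.invFun_add, mul_smul]

lemma crossCocycle_crossCocycle_swap (g : G) (z : X × Y) :
    crossCocycle b' b (crossCocycle b b' g z) z.swap = g := by
  simp only [crossCocycle, Prod.fst_swap, Prod.snd_swap, hb'.apply_invFun]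
  exact hb.invFun_eq_iff.2 rfl

lemma crossAct_crossCocycle (g : G) (z : X × Y) :
    crossAct b' b (crossCocycle b b' g z) z.swap = (crossAct b b' g z).swap := by
  rw [crossAct, crossCocycle_crossCocycle_swap hb hb']
  rfl

lemma measurableSet_crossCocycle_eq (g : G) (h : H) :
    MeasurableSet {z | crossCocycle b b' g z = h} := by
  simp only [crossCocycle, hb'.invFun_eq_iff]
  exact measurableSet_eq_fun ((hb'.measurable h).comp measurable_snd)
    ((hb.measurable g).comp measurable_fst)

lemma measurePreserving_crossAct [Countable H] [StandardBorelSpace Y] [MeasurableConstSMul G X]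
    [MeasurableConstSMul H Y] [SMulInvariantMeasure G X μ] [SMulInvariantMeasure H Y ν]
    [SFinite μ] [SFinite ν] (g : G) :
    MeasurePreserving (crossAct b b' g) (μ.prod ν) (μ.prod ν) :=
  (measurePreserving_smul g μ).skew_product
    (g := fun x y => Function.invFun (b' y) (b x g) • y)
    (hb'.measurable_invFun_smul measurable_snd ((hb.measurable g).comp measurable_fst))
    (.of_forall fun x => hb'.map_invFun_smul (b x g))

lemma integrable_crossCocycle [Countable H] [IsProbabilityMeasure μ] [IsProbabilityMeasure ν]
    (hr : 1 ≤ r) (hr' : 1 ≤ r') {s : ℝ} (hs : 0 < s) (hsr : s < (r' : ℝ) / r) (g : G) :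
    Integrable (fun z => (N' (crossCocycle b b' g z) : ℝ) ^ s) (μ.prod ν) := by
  have hr0 : (1 : ℝ) ≤ r := by exact_mod_cast hr
  have hr0' : (0 : ℝ) < r' := by exact_mod_cast hr'
  have hmeas : Measurable fun z => (N' (crossCocycle b b' g z) : ℝ) ^ s := by
    let _ : MeasurableSpace H := ⊤
    have h1 : Measurable (crossCocycle b b' g) :=
      measurable_to_countable' fun h => measurableSet_crossCocycle_eq hb hb' g h
    exact (measurable_from_top (f := fun h : H => (N' h : ℝ) ^ s)).comp h1
  have hlt : s / r' < 1 / r := by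
    rw [div_lt_div_iff₀ hr0' (by linarith), one_mul]
    exact (lt_div_iff₀ (by linarith)).1 hsr
  obtain ⟨θ, h1, h2⟩ := exists_between hlt
  have hθ : 0 < θ := (by positivity : 0 < s / r').trans h1
  have hθr : θ * r < 1 := (lt_div_iff₀ (by linarith)).1 h2
  obtain ⟨K, hK, hKn⟩ := hb'.exists_lintegral_le s θ hs
    (by rw [div_lt_iff₀ hr0'] at h1; linarith) hθ.le (by nlinarith)
  rw [← lintegral_ofReal_ne_top_iff_integrable hmeas.aestronglyMeasurable
    (.of_forall fun z => by positivity)]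
  refine ne_top_of_le_ne_top ?_ ((lintegral_prod _ hmeas.ennreal_ofReal.aemeasurable).trans_le
    (lintegral_mono fun x => hKn (b x g)))
  have h3 : ∀ x, ENNReal.ofReal (K * (1 + |(b x g : ℝ)| ^ θ)) =
      ENNReal.ofReal K * (1 + ENNReal.ofReal (|(b x g : ℝ)| ^ θ)) := fun x => by
    rw [ENNReal.ofReal_mul hK, ENNReal.ofReal_add zero_le_one (by positivity), ENNReal.ofReal_one]
  simp only [h3]
  rw [lintegral_const_mul' _ _ ENNReal.ofReal_ne_top, lintegral_add_left measurable_const,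
    lintegral_one, measure_univ]
  exact ENNReal.mul_ne_top ENNReal.ofReal_ne_top
    (ENNReal.add_ne_top.2 ⟨ENNReal.one_ne_top, (hb.lintegral_lt_top g θ hθ hθr).ne⟩)

end Cross

/-- infinite finitely generated torsion-free nilpotent groups `Γ`, `Λ` of
polynomial growth degrees `r_Γ`, `r_Λ ≥ 1` admit an orbit equivalence coupling which is
`(L^p, L^q)`-integrable for all `0 < p < r_Λ/r_Γ` and `0 < q < r_Γ/r_Λ`. -/
theorem oe_coupling_of_torsionfree_nilpotent
    {Γ : Type u} {Λ : Type v} [Group Γ] [Group Λ]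
    [Infinite Γ] [Infinite Λ] [Group.FG Γ] [Group.FG Λ]
    [Group.IsNilpotent Γ] [Group.IsNilpotent Λ]
    (htfΓ : ∀ γ : Γ, γ ≠ 1 → ¬IsOfFinOrder γ)
    (htfΛ : ∀ lam : Λ, lam ≠ 1 → ¬IsOfFinOrder lam)
    (SΓ : Set Γ) (hSΓ_fin : SΓ.Finite) (hSΓ_symm : SΓ⁻¹ = SΓ) (hSΓ_one : (1 : Γ) ∈ SΓ)
    (hSΓ_gen : Subgroup.closure SΓ = ⊤)
    (SΛ : Set Λ) (hSΛ_fin : SΛ.Finite) (hSΛ_symm : SΛ⁻¹ = SΛ) (hSΛ_one : (1 : Λ) ∈ SΛ)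
    (hSΛ_gen : Subgroup.closure SΛ = ⊤)
    (rΓ rΛ : ℕ) (hrΓ : 1 ≤ rΓ) (hrΛ : 1 ≤ rΛ)
    (hgrowthΓ : HasPolynomialGrowthDeg SΓ rΓ)
    (hgrowthΛ : HasPolynomialGrowthDeg SΛ rΛ) :
    ∃ c : OrbitEquivalenceCoupling Γ Λ,
      ∀ p q : ℝ, 0 < p → p < (rΛ : ℝ) / (rΓ : ℝ) → 0 < q → q < (rΓ : ℝ) / (rΛ : ℝ) →
        (∀ g : Γ, Integrable (fun x => (wordLength SΛ (c.alpha g x) : ℝ) ^ p) c.μ) ∧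
        (∀ h : Λ, Integrable (fun y => (wordLength SΓ (c.beta h y) : ℝ) ^ q) c.ν) := by
  obtain ⟨_, X, _, _, _, _, μ, _, _, b, hb⟩ :=
    hgrowthΓ.exists_integrableOrdering hSΓ_fin hSΓ_symm hSΓ_gen
  obtain ⟨_, Y, _, _, _, _, ν, _, _, b', hb'⟩ :=
    hgrowthΛ.exists_integrableOrdering hSΛ_fin hSΛ_symm hSΛ_gen
  have hG := measurePreserving_crossAct hb hb'
  have hH := measurePreserving_crossAct hb' hb
  let c : OrbitEquivalenceCoupling Γ Λ :=
    { X := X × Y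
      Y := Y × X
      sbX := inferInstance
      sbY := inferInstance
      μ := μ.prod ν
      ν := ν.prod μ
      probμ := inferInstance
      probν := inferInstance
      actG := crossAct b b'
      actH := crossAct b' b
      actG_one := crossAct_one hb hb'
      actH_one := crossAct_one hb' hb
      actG_mul := crossAct_mul hb hb'
      actH_mul := crossAct_mul hb' hb
      actG_meas := fun g => (hG g).measurable
      actH_meas := fun h => (hH h).measurable
      actG_pres := hG
      actH_pres := hH
      actG_free := .of_forall fun z g hz => hb.free z.1 g (congrArg Prod.fst hz)
      actH_free := .of_forall fun z h hz => hb'.free z.1 h (congrArg Prod.fst hz)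
      f := MeasurableEquiv.prodComm
      f_pres := Measure.measurePreserving_swap
      orbit_eq := .of_forall fun z => by
        ext w
        constructor
        · rintro ⟨g, rfl⟩
          exact ⟨_, crossAct_crossCocycle hb hb' g z⟩
        · rintro ⟨h, rfl⟩
          exact ⟨crossCocycle b' b h z.swap,
            congrArg Prod.swap (crossAct_crossCocycle hb' hb h z.swap)⟩
      alpha := crossCocycle b b'
      beta := crossCocycle b' b
      alpha_meas := measurableSet_crossCocycle_eq hb hb'
      beta_meas := measurableSet_crossCocycle_eq hb' hb
      alpha_spec := fun g => .of_forall (crossAct_crossCocycle hb hb' g)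
      beta_spec := fun h => .of_forall (crossAct_crossCocycle hb' hb h) }
  exact ⟨c, fun p q hp hpr hq hqr => ⟨integrable_crossCocycle hb hb' hrΓ hrΛ hp hpr,
    integrable_crossCocycle hb' hb hrΛ hrΓ hq hqr⟩⟩
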